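/- arXiv:2301.01177 — 5 statements merged into one kernel-verified Lean document; each statement's English description precedes it below -/
import Mathlib

section
/- For every finite group G and every irreducible complex character χ of G, χ(1)·χ(T_ℝ) = ε(χ)²·|G|², where T_ℝ = Σ_{x,y∈G} x·y⁻¹·x·y in the group algebra and ε(χ) is the Frobenius–Schur indicator of χ. In particular χ(T_ℝ) = 0 if χ is not real-valued, and χ(1)·χ(T_ℝ) = |G|² if χ is real-valued. -/
open scoped Classical

noncomputable section Defs

/-- `χ` is the character of some finite-dimensional complex representation of `G`. -/
def IsChar (G : Type*) [Group G] [Fintype G] (χ : G → ℂ) : Prop :=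
  ∃ (n : ℕ) (ρ : Representation ℂ G (Fin n → ℂ)),
    ∀ g : G, χ g = LinearMap.trace ℂ (Fin n → ℂ) (ρ g)

/-- `χ` is an irreducible character of `G` (a character of norm one). -/
def IsIrrChar (G : Type*) [Group G] [Fintype G] (χ : G → ℂ) : Prop :=
  IsChar G χ ∧ ∑ g : G, χ g * (starRingEnd ℂ) (χ g) = (Fintype.card G : ℂ)

/-- `χ` is a real-valued class function. -/
def IsRealChar (G : Type*) (χ : G → ℂ) : Prop :=
  ∀ g : G, (starRingEnd ℂ) (χ g) = χ g

variable {G : Type*} [Group G] [Fintype G]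

/-- extension of a function on a subgroup by zero. -/
def ext0 (H : Subgroup G) (θ : ↥H → ℂ) (g : G) : ℂ :=
  if h : g ∈ H then θ ⟨g, h⟩ else 0

/-- the character of `G` induced from the character `θ` of the subgroup `H`. -/
def Ind (H : Subgroup G) (θ : ↥H → ℂ) (g : G) : ℂ :=
  (∑ x : G, ext0 H θ (x * g * x⁻¹)) / (Nat.card H : ℂ)

/-- the character of an intermediate subgroup `K` (with `H ≤ K`) induced from `θ` on `H`. -/
def IndTo (H K : Subgroup G) (θ : ↥H → ℂ) (k : ↥K) : ℂ :=
  (∑ x : ↥K, ext0 H θ (↑x * ↑k * (↑x)⁻¹)) / (Nat.card H : ℂ)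

/-- the usual inner product of class functions on `H`. -/
def innerChar (H : Subgroup G) (φ ψ : ↥H → ℂ) : ℂ :=
  (∑ h : ↥H, φ h * (starRingEnd ℂ) (ψ h)) / (Nat.card H : ℂ)

/-- the conjugate character `θ^g : n ↦ θ (g n g⁻¹)`. -/
def conjChar (H : Subgroup G) (θ : ↥H → ℂ) (g : G) : ↥H → ℂ :=
  fun n => ext0 H θ (g * ↑n * g⁻¹)

/-- the Frobenius–Schur indicator. -/
def FSind (H : Type*) [Group H] [Fintype H] (χ : H → ℂ) : ℂ :=
  (∑ h : H, χ (h ^ 2)) / (Fintype.card H : ℂ)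

/-- the Gow indicator `ε_t(θ) = (1/|N|) ∑_{n ∈ N} θ((nt)²)`. -/
def Gow (H : Subgroup G) (θ : ↥H → ℂ) (t : G) : ℂ :=
  (∑ n : ↥H, ext0 H θ ((↑n * t) ^ 2)) / (Nat.card H : ℂ)

end Defs

open scoped ComplexOrder in
theorem aux_conj {G : Type*} [Group G] [Fintype G] {n : ℕ}
    (ρ : Representation ℂ G (Fin n → ℂ)) (h : G) :
    (starRingEnd ℂ) (ρ.character h) = ρ.character h⁻¹ := by
  let M : G → Matrix (Fin n) (Fin n) ℂ := fun g => LinearMap.toMatrix' (ρ g)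
  have hM : ∀ a b, M (a * b) = M a * M b := fun a b => by
    simp only [M, map_mul, LinearMap.toMatrix'_mul]
  have hM1 : M 1 = 1 := by simp [M]
  have htr : ∀ g, ρ.character g = (M g).trace := fun g => by
    simp only [M, Representation.character]
    rw [← Matrix.trace_toLin'_eq, Matrix.toLin'_toMatrix']
  let P : Matrix (Fin n) (Fin n) ℂ := ∑ g : G, (M g).conjTranspose * M g
  have hinj : ∀ g, Function.Injective (M g).mulVec := by
    intro g
    apply Matrix.mulVec_injective_of_isUnit
    refine ⟨⟨M g, M g⁻¹, ?_, ?_⟩, rfl⟩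
    · rw [← hM, mul_inv_cancel, hM1]
    · rw [← hM, inv_mul_cancel, hM1]
  have hP : P.PosDef := by
    apply Matrix.posDef_sum Finset.univ_nonempty
    intro g _
    exact Matrix.PosDef.conjTranspose_mul_self _ (hinj g)
  have hinv : (M h).conjTranspose * P * M h = P := by
    simp only [P, Finset.mul_sum, Finset.sum_mul]
    rw [← Equiv.sum_comp (Equiv.mulRight h) (fun g => (M g).conjTranspose * M g)]
    refine Finset.sum_congr rfl fun g _ => ?_
    simp only [Equiv.coe_mulRight, hM, Matrix.conjTranspose_mul, Matrix.mul_assoc]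
  have hinv2 : (M h).conjTranspose * P = P * M h⁻¹ := by
    conv_rhs => rw [← hinv]
    rw [Matrix.mul_assoc, ← hM, mul_inv_cancel, hM1, Matrix.mul_one]
  have hdet : IsUnit P.det := (Matrix.isUnit_iff_isUnit_det P).1 hP.isUnit
  rw [htr, htr, starRingEnd_apply, ← Matrix.trace_conjTranspose]
  calc (M h).conjTranspose.trace = ((M h).conjTranspose * P * P⁻¹).trace := by
        rw [Matrix.mul_nonsing_inv_cancel_right _ _ hdet]
    _ = (P⁻¹ * (P * M h⁻¹)).trace := by rw [hinv2, Matrix.trace_mul_comm]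
    _ = _ := by rw [Matrix.nonsing_inv_mul_cancel_left _ _ hdet]

/-- for `T_ℝ = ∑_{x,y} x y⁻¹ x y`, `χ(1)·χ(T_ℝ) = ε(χ)²·|G|²`. -/
theorem stmt2 {G : Type*} [Group G] [Fintype G] (χ : G → ℂ) (hχ : IsIrrChar G χ) :
    χ 1 * ∑ x : G, ∑ y : G, χ (x * y⁻¹ * x * y) =
      (FSind G χ) ^ 2 * (Fintype.card G : ℂ) ^ 2 := by
  obtain ⟨⟨n, ρ, hρ⟩, hnorm⟩ := hχ
  have hcard : (Fintype.card G : ℂ) ≠ 0 := by simp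
  have hcard' : (Nat.card G : ℂ) ≠ 0 := by simp
  have hch : ∀ g, χ g = ρ.character g := hρ
  have : Invertible (Nat.card G : ℂ) := invertibleOfNonzero hcard'
  have h1 := Representation.card_inv_mul_sum_char_mul_char_eq_finrank ρ ρ
  have h2 : ∑ g : G, ρ.character g * ρ.character g⁻¹ = (Nat.card G : ℂ) := by
    rw [Nat.card_eq_fintype_card, ← hnorm]
    refine Finset.sum_congr rfl fun g _ => ?_
    rw [hch, aux_conj]
  rw [h2, inv_mul_cancel₀ hcard'] at h1
  have h3 : Module.finrank ℂ (Representation.IntertwiningMap ρ ρ) = 1 := by exact_mod_cast h1.symm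
  obtain ⟨v, hv0, hv⟩ := finrank_eq_one_iff'.1 h3
  let z : Module.End ℂ (Fin n → ℂ) := ∑ g : G, ρ (g ^ 2)
  have hz : ∀ g, z * ρ g = ρ g * z := by
    intro g
    simp only [z, Finset.mul_sum, Finset.sum_mul]
    rw [← Equiv.sum_comp (MulAut.conj g).toEquiv (fun a => ρ (a ^ 2) * ρ g)]
    refine Finset.sum_congr rfl fun a _ => ?_
    rw [← map_mul, ← map_mul]
    congr 1
    simp [pow_two, mul_assoc]
  let Z : Representation.IntertwiningMap ρ ρ := ⟨z, hz⟩
  obtain ⟨c0, hc0⟩ := hv (Representation.IntertwiningMap.id ρ)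
  obtain ⟨c, hc⟩ := hv Z
  have hc0n : c0 ≠ 0 := by
    rintro rfl
    apply hv0
    rw [zero_smul] at hc0
    ext1
    have := congrArg (fun f => f.toLinearMap) hc0
    apply LinearMap.ext
    intro w
    have hw : w = 0 := by
      have := LinearMap.congr_fun this w
      simpa using this.symm
    rw [hw]; simp
  have hscal : z = (c / c0) • (1 : Module.End ℂ (Fin n → ℂ)) := by
    have e : Z = (c / c0) • Representation.IntertwiningMap.id ρ := by
      rw [← hc0, smul_smul, div_mul_cancel₀ _ hc0n, hc]
    exact congrArg (fun f => f.toLinearMap) e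
  have hF : FSind G χ * (Fintype.card G : ℂ) = LinearMap.trace ℂ _ z := by
    rw [FSind, div_mul_cancel₀ _ hcard]
    simp [z, hρ]
  have hS : ∑ x : G, ∑ y : G, χ (x * y⁻¹ * x * y) = LinearMap.trace ℂ _ (z * z) := by
    rw [Finset.sum_comm]
    have : ∀ y : G, ∑ x : G, χ (x * y⁻¹ * x * y) = ∑ a : G, χ (a ^ 2 * y ^ 2) := by
      intro y
      rw [← Equiv.sum_comp (Equiv.mulRight y)]
      refine Finset.sum_congr rfl fun a _ => ?_
      congr 1
      simp [pow_two, mul_assoc]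
    rw [Finset.sum_congr rfl fun y _ => this y]
    simp only [z, Finset.sum_mul, Finset.mul_sum, map_sum, hρ, map_mul]
  rw [← mul_pow, hF, hS, hρ, map_one, hscal]
  simp only [smul_mul_smul_comm, mul_one, map_smul, smul_eq_mul]
  ring
end

section
/- Let N be a normal subgroup of a finite group G with |G/N| odd, and let θ be a real-valued G-invariant irreducible character of N. Then there is exactly one real-valued irreducible character χ of G lying over θ, and this χ restricts to θ on N (i.e. χ is an extension of θ). -/
open scoped Classical

open Matrix

set_option linter.unusedSectionVars false

namespace Richards

/-- norm one for a matrix representation. -/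
def Nrm {G : Type*} [Group G] [Fintype G] {d : ℕ} (D : G →* Matrix (Fin d) (Fin d) ℂ) : Prop :=
  ∑ g : G, (D g).trace * (D g⁻¹).trace = (Fintype.card G : ℂ)

lemma isChar_iff {G : Type*} [Group G] [Fintype G] (χ : G → ℂ) :
    IsChar G χ ↔ ∃ (d : ℕ) (D : G →* Matrix (Fin d) (Fin d) ℂ), ∀ g, χ g = (D g).trace := by
  constructor
  · rintro ⟨n, ρ, h⟩
    refine ⟨n, (LinearMap.toMatrixAlgEquiv' : _ ≃ₐ[ℂ] Matrix (Fin n) (Fin n) ℂ).toAlgHom.toMonoidHom.comp ρ, fun g => ?_⟩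
    rw [h, LinearMap.trace_eq_matrix_trace ℂ (Pi.basisFun ℂ (Fin n))]
    rfl
  · rintro ⟨n, D, h⟩
    refine ⟨n, (LinearMap.toMatrixAlgEquiv' : _ ≃ₐ[ℂ] Matrix (Fin n) (Fin n) ℂ).symm.toAlgHom.toMonoidHom.comp D, fun g => ?_⟩
    rw [h, LinearMap.trace_eq_matrix_trace ℂ (Pi.basisFun ℂ (Fin n))]
    congr 1
    exact ((LinearMap.toMatrixAlgEquiv' : _ ≃ₐ[ℂ] Matrix (Fin n) (Fin n) ℂ).apply_symm_apply (D g)).symm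

section
variable {G : Type*} [Group G] {d e : ℕ}

lemma mul_inv_D (D : G →* Matrix (Fin d) (Fin d) ℂ) (g : G) : D g * D g⁻¹ = 1 := by
  rw [← map_mul]; simp

lemma inv_mul_D (D : G →* Matrix (Fin d) (Fin d) ℂ) (g : G) : D g⁻¹ * D g = 1 := by
  rw [← map_mul]; simp

variable [Fintype G]

open scoped ComplexOrder in
lemma trace_inv (D : G →* Matrix (Fin d) (Fin d) ℂ) (g : G) :
    (D g⁻¹).trace = (starRingEnd ℂ) (D g).trace := by
  set H : Matrix (Fin d) (Fin d) ℂ := ∑ x : G, (D x)ᴴ * D x with hH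
  have hpos : H.PosDef := by
    apply Matrix.posDef_sum ⟨1, Finset.mem_univ _⟩
    intro x _
    apply PosDef.conjTranspose_mul_self
    apply Matrix.mulVec_injective_of_isUnit
    exact IsUnit.of_mul_eq_one _ (mul_inv_D D x)
  have hinv : (D g)ᴴ * H * D g = H := by
    rw [hH, Finset.mul_sum, Finset.sum_mul]
    refine Fintype.sum_equiv (Equiv.mulRight g) _ _ fun x => ?_
    simp [Matrix.conjTranspose_mul, Matrix.mul_assoc]
  have h2 : (D g)ᴴ * H = H * D g⁻¹ := by
    calc (D g)ᴴ * H = (D g)ᴴ * H * (D g * D g⁻¹) := by rw [mul_inv_D, mul_one]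
      _ = _ := by rw [← mul_assoc, hinv]
  obtain ⟨u, hu⟩ := hpos.isUnit
  have h3 : D g⁻¹ = (↑u⁻¹ : Matrix _ _ ℂ) * ((D g)ᴴ * H) := by
    rw [h2, ← hu, ← mul_assoc, Units.inv_mul, one_mul]
  rw [h3, Matrix.trace_mul_comm, mul_assoc, ← hu, Units.mul_inv, mul_one,
    Matrix.trace_conjTranspose]
  rfl

lemma dim_ne (D : G →* Matrix (Fin d) (Fin d) ℂ) (hD : Nrm D) : (d : ℂ) ≠ 0 := by
  intro h
  have : d = 0 := by exact_mod_cast h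
  subst this
  have hc : (Fintype.card G : ℂ) ≠ 0 := by simp
  apply hc
  rw [← hD]
  simp [Matrix.trace]

lemma card_ne : (Fintype.card G : ℂ) ≠ 0 := by
  simp

/-- the averaging operator. -/
noncomputable def avg (D : G →* Matrix (Fin d) (Fin d) ℂ) :
    Matrix (Fin d) (Fin d) ℂ →ₗ[ℂ] Matrix (Fin d) (Fin d) ℂ where
  toFun A := (Fintype.card G : ℂ)⁻¹ • ∑ g : G, D g * A * D g⁻¹
  map_add' A B := by simp [mul_add, add_mul, Finset.sum_add_distrib]
  map_smul' c A := by
    simp only [Matrix.mul_smul, Matrix.smul_mul, ← Finset.smul_sum, RingHom.id_apply]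
    rw [smul_comm]

lemma sum_comm_D (D : G →* Matrix (Fin d) (Fin d) ℂ) (A : Matrix (Fin d) (Fin d) ℂ) (x : G) :
    D x * (∑ g : G, D g * A * D g⁻¹) * D x⁻¹ = ∑ g : G, D g * A * D g⁻¹ := by
  rw [Finset.mul_sum, Finset.sum_mul]
  refine Fintype.sum_equiv (Equiv.mulLeft x) _ _ fun y => ?_
  simp [Matrix.mul_assoc]

lemma avg_of_comm (D : G →* Matrix (Fin d) (Fin d) ℂ) (A : Matrix (Fin d) (Fin d) ℂ)
    (h : ∀ x, D x * A * D x⁻¹ = A) : avg D A = A := by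
  show (Fintype.card G : ℂ)⁻¹ • ∑ g : G, D g * A * D g⁻¹ = A
  simp only [h]
  rw [Finset.sum_const, Finset.card_univ, ← Nat.cast_smul_eq_nsmul ℂ, smul_smul,
    inv_mul_cancel₀ card_ne, one_smul]

lemma avg_comm (D : G →* Matrix (Fin d) (Fin d) ℂ) (A : Matrix (Fin d) (Fin d) ℂ) (x : G) :
    D x * avg D A * D x⁻¹ = avg D A := by
  show D x * ((Fintype.card G : ℂ)⁻¹ • ∑ g : G, D g * A * D g⁻¹) * D x⁻¹ =
    ((Fintype.card G : ℂ)⁻¹ • ∑ g : G, D g * A * D g⁻¹)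
  rw [Matrix.mul_smul, Matrix.smul_mul, sum_comm_D]

lemma trace_avg (D : G →* Matrix (Fin d) (Fin d) ℂ) :
    LinearMap.trace ℂ _ (avg D) =
      (Fintype.card G : ℂ)⁻¹ * ∑ g : G, (D g).trace * (D g⁻¹).trace := by
  rw [LinearMap.trace_eq_matrix_trace ℂ (Matrix.stdBasis ℂ (Fin d) (Fin d))]
  have key : ∀ i j : Fin d, avg D (Matrix.single i j 1) i j =
      (Fintype.card G : ℂ)⁻¹ * ∑ g : G, D g i i * D g⁻¹ j j := by
    intro i j
    show ((Fintype.card G : ℂ)⁻¹ • ∑ g : G, D g * Matrix.single i j 1 * D g⁻¹ : Matrix (Fin d) (Fin d) ℂ) i j = _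
    rw [Matrix.smul_apply, Matrix.sum_apply, smul_eq_mul]
    congr 1
    refine Finset.sum_congr rfl fun g _ => ?_
    rw [Matrix.mul_apply, Finset.sum_eq_single j]
    · simp
    · intro b _ hb
      rw [Matrix.mul_single_apply_of_ne _ _ _ _ _ hb, zero_mul]
    · simp
  have h2 : ((LinearMap.toMatrix (Matrix.stdBasis ℂ (Fin d) (Fin d))
      (Matrix.stdBasis ℂ (Fin d) (Fin d))) (avg D)).trace
      = ∑ p : Fin d × Fin d, avg D (Matrix.single p.1 p.2 1) p.1 p.2 := by
    refine Finset.sum_congr rfl fun p _ => ?_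
    obtain ⟨i, j⟩ := p
    rw [Matrix.diag_apply, LinearMap.toMatrix_apply, Matrix.stdBasis_eq_single]
    rfl
  rw [h2]
  simp only [key]
  rw [← Finset.mul_sum, Finset.sum_comm]
  congr 1
  refine Finset.sum_congr rfl fun g _ => ?_
  rw [Fintype.sum_prod_type, Matrix.trace, Matrix.trace, Finset.sum_mul_sum]
  rfl

lemma schur_comm (D : G →* Matrix (Fin d) (Fin d) ℂ) (hD : Nrm D)
    (A : Matrix (Fin d) (Fin d) ℂ) (h : ∀ x, D x * A * D x⁻¹ = A) : ∃ c : ℂ, A = c • 1 := by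
  have hd := dim_ne D hD
  have hidem : IsIdempotentElem (avg D) := by
    ext1 B
    exact avg_of_comm D _ (avg_comm D B)
  have htr := (LinearMap.IsIdempotentElem.isProj_range _ hidem).trace
  rw [trace_avg, hD, inv_mul_cancel₀ card_ne] at htr
  have hfr : Module.finrank ℂ (LinearMap.range (avg D)) = 1 := by exact_mod_cast htr.symm
  have h1 : (1 : Matrix (Fin d) (Fin d) ℂ) ∈ LinearMap.range (avg D) :=
    ⟨1, avg_of_comm D 1 fun x => by rw [mul_one, mul_inv_D]⟩
  have hne : (⟨1, h1⟩ : LinearMap.range (avg D)) ≠ 0 := by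
    intro h0
    have h0' : (1 : Matrix (Fin d) (Fin d) ℂ) = 0 := congrArg Subtype.val h0
    have := congrArg Matrix.trace h0'
    simp at this
    exact hd (by exact_mod_cast this)
  obtain ⟨c, hc⟩ := (finrank_eq_one_iff_of_nonzero' _ hne).1 hfr ⟨A, A, avg_of_comm D A h⟩
  exact ⟨c, (congrArg Subtype.val hc).symm⟩

lemma schur_sum (D : G →* Matrix (Fin d) (Fin d) ℂ) (hD : Nrm D)
    (A : Matrix (Fin d) (Fin d) ℂ) :
    ∑ g : G, D g * A * D g⁻¹ = (Fintype.card G / d * A.trace : ℂ) • 1 := by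
  have hd := dim_ne D hD
  obtain ⟨c, hc⟩ := schur_comm D hD (∑ g : G, D g * A * D g⁻¹) (sum_comm_D D A)
  have ht := congrArg Matrix.trace hc
  rw [Matrix.trace_sum] at ht
  have : ∀ g : G, (D g * A * D g⁻¹).trace = A.trace := fun g => by
    rw [Matrix.trace_mul_comm, ← mul_assoc, inv_mul_D, one_mul]
  simp only [this, Finset.sum_const, Finset.card_univ, nsmul_eq_mul, Matrix.trace_smul,
    Matrix.trace_one, Fintype.card_fin, smul_eq_mul] at ht
  rw [hc]
  congr 1
  field_simp
  exact ht.symm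

lemma schur_entry (D : G →* Matrix (Fin d) (Fin d) ℂ) (hD : Nrm D) (a b c f : Fin d) :
    ∑ g : G, D g a b * D g⁻¹ c f =
      (Fintype.card G / d : ℂ) * ((if b = c then 1 else 0) * (if a = f then 1 else 0)) := by
  have h := congrFun (congrFun (schur_sum D hD (Matrix.single b c 1)) a) f
  rw [Matrix.sum_apply] at h
  have h2 : ∀ g : G, (D g * Matrix.single b c 1 * D g⁻¹ : Matrix (Fin d) (Fin d) ℂ) a f = D g a b * D g⁻¹ c f := by
    intro g
    rw [Matrix.mul_apply, Finset.sum_eq_single c]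
    · simp
    · intro x _ hb
      rw [Matrix.mul_single_apply_of_ne _ _ _ _ _ hb, zero_mul]
    · simp
  simp only [h2] at h
  rw [h, Matrix.smul_apply, Matrix.one_apply, smul_eq_mul, mul_assoc]
  congr 2
  split_ifs with hbc
  · subst hbc; simp
  · exact Matrix.trace_single_eq_of_ne _ _ _ hbc

lemma schur_trace (D : G →* Matrix (Fin d) (Fin d) ℂ) (hD : Nrm D)
    (X : Matrix (Fin d) (Fin d) ℂ) :
    ∑ g : G, (X * D g).trace • D g⁻¹ = (Fintype.card G / d : ℂ) • X := by
  ext c f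
  rw [Matrix.sum_apply]
  simp only [Matrix.smul_apply, smul_eq_mul, Matrix.trace, Matrix.diag_apply, Matrix.mul_apply,
    Finset.sum_mul]
  rw [Finset.sum_comm]
  simp only [Finset.sum_comm (s := (Finset.univ : Finset G)), mul_assoc, ← Finset.mul_sum,
    schur_entry D hD]
  simp [mul_comm]

lemma schur_transpose (D : G →* Matrix (Fin d) (Fin d) ℂ) (hD : Nrm D)
    (X : Matrix (Fin d) (Fin d) ℂ) :
    ∑ g : G, (D g⁻¹)ᵀ * X * D g = (Fintype.card G / d : ℂ) • Xᵀ := by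
  ext a f
  rw [Matrix.sum_apply]
  have h : ∀ g : G, ((D g⁻¹)ᵀ * X * D g) a f = ∑ c, ∑ b, X b c * (D g c f * D g⁻¹ b a) := by
    intro g
    simp only [Matrix.mul_apply, Matrix.transpose_apply, Finset.sum_mul]
    refine Finset.sum_congr rfl fun c _ => Finset.sum_congr rfl fun b _ => by ring
  simp only [h]
  rw [Finset.sum_comm]
  simp only [Finset.sum_comm (s := (Finset.univ : Finset G)), ← Finset.mul_sum,
    schur_entry D hD]
  simp [mul_comm]

lemma exists_intertwiner (D : G →* Matrix (Fin d) (Fin d) ℂ) (E : G →* Matrix (Fin e) (Fin e) ℂ)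
    (h : ∑ g : G, (D g).trace * (E g⁻¹).trace ≠ 0) :
    ∃ T : Matrix (Fin d) (Fin e) ℂ, T ≠ 0 ∧ ∀ g, D g * T = T * E g := by
  by_contra! hcon
  apply h
  have hz : ∀ X : Matrix (Fin d) (Fin e) ℂ, ∑ g : G, D g * X * E g⁻¹ = 0 := by
    intro X
    by_contra hX
    obtain ⟨g, hg⟩ := hcon _ hX
    apply hg
    rw [Matrix.mul_sum, Matrix.sum_mul]
    refine Fintype.sum_equiv (Equiv.mulLeft g) _ _ fun y => ?_
    simp only [Equiv.coe_mulLeft, map_mul, _root_.mul_inv_rev, Matrix.mul_assoc]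
    rw [inv_mul_D, Matrix.mul_one]
  have hz2 : ∀ i j, ∑ g : G, D g i i * E g⁻¹ j j = 0 := by
    intro i j
    have h1 := congrFun (congrFun (hz (Matrix.single i j 1)) i) j
    rw [Matrix.sum_apply, Matrix.zero_apply] at h1
    rw [← h1]
    refine Finset.sum_congr rfl fun g _ => ?_
    rw [Matrix.mul_apply, Finset.sum_eq_single j]
    · simp
    · intro x _ hb
      rw [Matrix.mul_single_apply_of_ne _ _ _ _ _ hb, zero_mul]
    · simp
  simp only [Matrix.trace, Matrix.diag_apply, Finset.sum_mul_sum]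
  rw [Finset.sum_comm]
  refine Finset.sum_eq_zero fun i _ => ?_
  rw [Finset.sum_comm]
  exact Finset.sum_eq_zero fun j _ => hz2 i j

lemma exists_trace_ne {T : Matrix (Fin d) (Fin e) ℂ} (hT : T ≠ 0) :
    ∃ L : Matrix (Fin e) (Fin d) ℂ, (T * L).trace ≠ 0 := by
  by_contra! h
  apply hT
  rw [Matrix.ext_iff_trace_mul_right]
  intro x
  rw [h, Matrix.zero_mul, Matrix.trace_zero]

lemma intertwiner_inv (D : G →* Matrix (Fin d) (Fin d) ℂ) (E : G →* Matrix (Fin e) (Fin e) ℂ)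
    (hD : Nrm D) (hE : Nrm E) (T : Matrix (Fin d) (Fin e) ℂ) (hT : T ≠ 0)
    (h : ∀ g, D g * T = T * E g) :
    ∃ T' : Matrix (Fin e) (Fin d) ℂ, T * T' = 1 ∧ T' * T = 1 := by
  obtain ⟨L, hL⟩ := exists_trace_ne hT
  have hd := dim_ne D hD
  have he := dim_ne E hE
  have hc := card_ne (G := G)
  have h1 : T * (∑ g : G, E g * L * D g⁻¹) = (Fintype.card G / d * (T * L).trace : ℂ) • 1 := by
    rw [← schur_sum D hD, Matrix.mul_sum]
    refine Finset.sum_congr rfl fun g _ => ?_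
    rw [← Matrix.mul_assoc, ← Matrix.mul_assoc, ← h, Matrix.mul_assoc (D g)]
  have h2 : (∑ g : G, E g * L * D g⁻¹) * T = (Fintype.card G / e * (L * T).trace : ℂ) • 1 := by
    rw [← schur_sum E hE, Matrix.sum_mul]
    refine Finset.sum_congr rfl fun g _ => ?_
    rw [Matrix.mul_assoc, h]
    simp only [Matrix.mul_assoc]
  have hR : T * ((Fintype.card G / d * (T * L).trace : ℂ)⁻¹ • ∑ g : G, E g * L * D g⁻¹) = 1 := by
    rw [Matrix.mul_smul, h1, smul_smul, inv_mul_cancel₀, one_smul]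
    positivity
  have hLe : ((Fintype.card G / e * (L * T).trace : ℂ)⁻¹ • ∑ g : G, E g * L * D g⁻¹) * T = 1 := by
    rw [Matrix.smul_mul, h2, smul_smul, inv_mul_cancel₀, one_smul]
    rw [Matrix.trace_mul_comm]
    positivity
  refine ⟨_, hR, ?_⟩
  have : ((Fintype.card G / e * (L * T).trace : ℂ)⁻¹ • ∑ g : G, E g * L * D g⁻¹) =
      ((Fintype.card G / d * (T * L).trace : ℂ)⁻¹ • ∑ g : G, E g * L * D g⁻¹) := by
    rw [← Matrix.mul_one ((Fintype.card G / e * (L * T).trace : ℂ)⁻¹ • _), ← hR,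
      ← Matrix.mul_assoc, hLe, Matrix.one_mul]
  rw [← this]; exact hLe

lemma char_eq_of_ne (D : G →* Matrix (Fin d) (Fin d) ℂ) (E : G →* Matrix (Fin e) (Fin e) ℂ)
    (hD : Nrm D) (hE : Nrm E) (h : ∑ g : G, (D g).trace * (E g⁻¹).trace ≠ 0) (g : G) :
    (D g).trace = (E g).trace := by
  obtain ⟨T, hT, hi⟩ := exists_intertwiner D E h
  obtain ⟨T', h1, h2⟩ := intertwiner_inv D E hD hE T hT hi
  rw [← Matrix.mul_one (D g), ← h1, ← Matrix.mul_assoc, hi, Matrix.trace_mul_comm,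
    ← Matrix.mul_assoc, h2, Matrix.one_mul]

lemma exists_form (D : G →* Matrix (Fin d) (Fin d) ℂ) (hD : Nrm D)
    (hr : ∀ g, (D g⁻¹).trace = (D g).trace) :
    ∃ (J J' : Matrix (Fin d) (Fin d) ℂ) (ε : ℂ), ε * ε = 1 ∧ Jᵀ = ε • J ∧ J * J' = 1 ∧
      J' * J = 1 ∧ ∀ g, D g * J * (D g)ᵀ = J := by
  let E : G →* Matrix (Fin d) (Fin d) ℂ :=
    { toFun := fun g => (D g⁻¹)ᵀ
      map_one' := by simp
      map_mul' := fun x y => by simp }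
  have hEtr : ∀ g, (E g).trace = (D g).trace := fun g => by
    show ((D g⁻¹)ᵀ).trace = _
    rw [Matrix.trace_transpose, hr]
  have hE : Nrm E := by simp only [Nrm, hEtr]; exact hD
  obtain ⟨J, hJ, hi⟩ := exists_intertwiner D E (by
    simp only [hEtr]; rw [hD]; exact card_ne)
  obtain ⟨J', h1, h2⟩ := intertwiner_inv D E hD hE J hJ hi
  have hinv : ∀ g, D g * J * (D g)ᵀ = J := fun g => by
    rw [hi, mul_assoc]
    show J * ((D g⁻¹)ᵀ * (D g)ᵀ) = J
    rw [← Matrix.transpose_mul, mul_inv_D, Matrix.transpose_one, mul_one]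
  have hinvT : ∀ g, D g * Jᵀ * (D g)ᵀ = Jᵀ := fun g => by
    conv_rhs => rw [← hinv g]
    simp [Matrix.transpose_mul, Matrix.mul_assoc]
  have hJ' : ∀ g, J' * D g⁻¹ = (D g)ᵀ * J' := fun g => by
    calc J' * D g⁻¹ = J' * D g⁻¹ * (D g * J * (D g)ᵀ) * J' := by
          rw [hinv, mul_assoc, h1, mul_one]
      _ = J' * (D g⁻¹ * D g) * J * (D g)ᵀ * J' := by simp only [mul_assoc]
      _ = _ := by rw [inv_mul_D, mul_one, h2, one_mul]
  obtain ⟨ε, hε⟩ := schur_comm D hD (Jᵀ * J') (fun g => by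
    calc D g * (Jᵀ * J') * D g⁻¹ = D g * Jᵀ * (J' * D g⁻¹) := by simp only [mul_assoc]
      _ = (D g * Jᵀ * (D g)ᵀ) * J' := by rw [hJ']; simp only [mul_assoc]
      _ = _ := by rw [hinvT])
  have hJT : Jᵀ = ε • J := by
    calc Jᵀ = Jᵀ * J' * J := by rw [mul_assoc, h2, mul_one]
      _ = _ := by rw [hε, Matrix.smul_mul, one_mul]
  refine ⟨J, J', ε, ?_, hJT, h1, h2, hinv⟩
  have h3 : J = (ε * ε) • J := by
    calc J = Jᵀᵀ := by simp
      _ = _ := by rw [hJT, Matrix.transpose_smul, hJT, smul_smul]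
  have h4 : (1 - ε * ε) • J = 0 := by rw [sub_smul, one_smul, ← h3, sub_self]
  rcases smul_eq_zero.1 h4 with h | h
  · linear_combination -h
  · exact absurd h hJ

lemma sum_DAD (D : G →* Matrix (Fin d) (Fin d) ℂ) (hD : Nrm D)
    {J J' : Matrix (Fin d) (Fin d) ℂ} {ε : ℂ} (hε : ε * ε = 1) (hJT : Jᵀ = ε • J)
    (h1 : J * J' = 1) (hinv : ∀ g, D g * J * (D g)ᵀ = J)
    (A : Matrix (Fin d) (Fin d) ℂ) :
    ∑ g : G, D g * A * D g = (ε * (Fintype.card G / d) : ℂ) • (J * Aᵀ * J') := by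
  have hDg : ∀ g, D g = J * (D g⁻¹)ᵀ * J' := fun g => by
    calc D g = (D g * J * (D g)ᵀ) * (D g⁻¹)ᵀ * J' := by
          rw [mul_assoc (D g * J), ← Matrix.transpose_mul, inv_mul_D, Matrix.transpose_one,
            mul_one, mul_assoc, h1, mul_one]
      _ = _ := by rw [hinv]
  have hJ'T : J'ᵀ = ε • J' := by
    have h3 : J'ᵀ * Jᵀ = 1 := by rw [← Matrix.transpose_mul, h1, Matrix.transpose_one]
    rw [hJT, Matrix.mul_smul] at h3
    calc J'ᵀ = (ε * ε) • (J'ᵀ * (J * J')) := by rw [hε, h1, mul_one, one_smul]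
      _ = ε • ((ε • (J'ᵀ * J)) * J') := by
        rw [Matrix.smul_mul, smul_smul, mul_assoc]
      _ = _ := by rw [h3, one_mul]
  calc ∑ g : G, D g * A * D g = ∑ g : G, J * ((D g⁻¹)ᵀ * (J' * A) * D g) := by
        refine Finset.sum_congr rfl fun g _ => ?_
        have h5 : D g * (A * D g) = J * (D g⁻¹)ᵀ * J' * (A * D g) := by rw [← hDg g]
        rw [mul_assoc, h5]
        simp only [mul_assoc]
    _ = _ := by
      rw [← Finset.mul_sum, schur_transpose D hD, Matrix.transpose_mul, hJ'T, Matrix.mul_smul,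
        Matrix.mul_smul, Matrix.mul_smul, smul_smul, mul_comm ε, mul_assoc]

lemma frobenius_schur (D : G →* Matrix (Fin d) (Fin d) ℂ) (hD : Nrm D)
    (hr : ∀ g, (D g⁻¹).trace = (D g).trace) : ∑ g : G, (D (g * g)).trace ≠ 0 := by
  obtain ⟨J, J', ε, hε, hJT, h1, h2, hinv⟩ := exists_form D hD hr
  have h := congrArg Matrix.trace (sum_DAD D hD hε hJT h1 hinv 1)
  rw [Matrix.trace_sum] at h
  simp only [mul_one, ← map_mul, Matrix.transpose_one, h1, Matrix.trace_smul,
    Matrix.trace_one, Fintype.card_fin] at h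
  rw [h]
  have hd := dim_ne D hD
  have hε0 : ε ≠ 0 := by rintro rfl; simp at hε
  have := card_ne (G := G)
  simp [smul_eq_mul, hd, hε0]

end

section
variable {G : Type*} [Group G] [Fintype G] {d e : ℕ}

lemma form_unique (D : G →* Matrix (Fin d) (Fin d) ℂ) (hD : Nrm D)
    {J J' K : Matrix (Fin d) (Fin d) ℂ}
    (h1 : J * J' = 1) (h2 : J' * J = 1) (hinv : ∀ g, D g * J * (D g)ᵀ = J)
    (hK : ∀ g, D g * K * (D g)ᵀ = K) : ∃ c : ℂ, K = c • J := by
  have hJ' : ∀ g, J' * D g⁻¹ = (D g)ᵀ * J' := fun g => by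
    calc J' * D g⁻¹ = J' * D g⁻¹ * (D g * J * (D g)ᵀ) * J' := by
          rw [hinv, mul_assoc, h1, mul_one]
      _ = J' * (D g⁻¹ * D g) * J * (D g)ᵀ * J' := by simp only [mul_assoc]
      _ = _ := by rw [inv_mul_D, mul_one, h2, one_mul]
  obtain ⟨c, hc⟩ := schur_comm D hD (K * J') (fun g => by
    calc D g * (K * J') * D g⁻¹ = D g * K * (J' * D g⁻¹) := by simp only [mul_assoc]
      _ = (D g * K * (D g)ᵀ) * J' := by rw [hJ']; simp only [mul_assoc]
      _ = _ := by rw [hK])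
  refine ⟨c, ?_⟩
  calc K = K * J' * J := by rw [mul_assoc, h2, mul_one]
      _ = _ := by rw [hc, Matrix.smul_mul, one_mul]

/-- `T` intertwines `D` with its conjugate by `g` and preserves the form `J`. -/
def Good (N : Subgroup G) [N.Normal] (D : N →* Matrix (Fin d) (Fin d) ℂ)
    (J : Matrix (Fin d) (Fin d) ℂ) (g : G) (T : Matrix (Fin d) (Fin d) ℂ) : Prop :=
  T * J * Tᵀ = J ∧ ∀ n : N, T * D n = D (MulAut.conjNormal g n) * T

variable {N : Subgroup G} [N.Normal] {D : N →* Matrix (Fin d) (Fin d) ℂ}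
  {J J' : Matrix (Fin d) (Fin d) ℂ}

lemma Good.mul {g h : G} {T U : Matrix (Fin d) (Fin d) ℂ} (hT : Good N D J g T)
    (hU : Good N D J h U) : Good N D J (g * h) (T * U) := by
  refine ⟨?_, fun n => ?_⟩
  · rw [Matrix.transpose_mul]
    calc T * U * J * (Uᵀ * Tᵀ) = T * (U * J * Uᵀ) * Tᵀ := by simp only [mul_assoc]
      _ = J := by rw [hU.1, hT.1]
  · rw [mul_assoc, hU.2, ← mul_assoc, hT.2, mul_assoc, map_mul]
    rfl

lemma Good.smul {g : G} {T : Matrix (Fin d) (Fin d) ℂ} (hT : Good N D J g T) {s : ℂ}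
    (hs : s * s = 1) : Good N D J g (s • T) := by
  refine ⟨?_, fun n => ?_⟩
  · rw [Matrix.transpose_smul, Matrix.smul_mul, Matrix.smul_mul, Matrix.mul_smul, smul_smul, hs,
      one_smul, hT.1]
  · rw [Matrix.smul_mul, hT.2, Matrix.mul_smul]

lemma good_D (hinv : ∀ g, D g * J * (D g)ᵀ = J) (n : N) : Good N D J n (D n) := by
  refine ⟨hinv n, fun m => ?_⟩
  rw [← map_mul, ← map_mul]
  congr 1
  ext
  simp [MulAut.conjNormal_apply]

lemma J_ne (hD : Nrm D) (h1 : J * J' = 1) : J ≠ 0 := by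
  rintro rfl
  have := congrArg Matrix.trace h1
  simp at this
  exact dim_ne D hD (by exact_mod_cast this.symm)

lemma Good.ne {g : G} {T : Matrix (Fin d) (Fin d) ℂ} (hD : Nrm D) (h1 : J * J' = 1)
    (hT : Good N D J g T) : T ≠ 0 := by
  rintro rfl
  apply J_ne hD h1
  rw [← hT.1]; simp

lemma good_unique (hD : Nrm D) (h1 : J * J' = 1)
    {g : G} {T U : Matrix (Fin d) (Fin d) ℂ} (hT : Good N D J g T)
    (hU : Good N D J g U) : ∃ s : ℂ, s * s = 1 ∧ T = s • U := by
  have hUi : U * (J * Uᵀ * J') = 1 := by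
    rw [← mul_assoc, ← mul_assoc, hU.1, h1]
  have hUi' : (J * Uᵀ * J') * U = 1 := mul_eq_one_comm.1 hUi
  set U' := J * Uᵀ * J' with hU'
  have hc : ∀ n : N, U' * D (MulAut.conjNormal g n) = D n * U' := fun n => by
    calc U' * D (MulAut.conjNormal g n) = U' * (D (MulAut.conjNormal g n) * U) * U' := by
          rw [mul_assoc U', mul_assoc _ U, hUi, mul_one]
      _ = (U' * U) * D n * U' := by rw [← hU.2]; simp only [mul_assoc]
      _ = _ := by rw [hUi', one_mul]
  obtain ⟨s, hs⟩ := schur_comm D hD (T * U') (fun m => by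
    obtain ⟨n, rfl⟩ := (MulAut.conjNormal g : MulAut N).surjective m
    calc D (MulAut.conjNormal g n) * (T * U') * D (MulAut.conjNormal g n)⁻¹
        = T * D n * U' * D (MulAut.conjNormal g n)⁻¹ := by rw [hT.2]; simp only [mul_assoc]
      _ = T * (U' * D (MulAut.conjNormal g n)) * D (MulAut.conjNormal g n)⁻¹ := by
          rw [hc]; simp only [mul_assoc]
      _ = T * U' * (D (MulAut.conjNormal g n) * D (MulAut.conjNormal g n)⁻¹) := by
          simp only [mul_assoc]
      _ = _ := by rw [mul_inv_D, mul_one])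
  have hTU : T = s • U := by
    calc T = T * U' * U := by rw [mul_assoc, hUi', mul_one]
      _ = _ := by rw [hs, Matrix.smul_mul, one_mul]
  refine ⟨s, ?_, hTU⟩
  have h3 : (s * s) • J = J := by
    conv_rhs => rw [← hT.1, hTU]
    rw [Matrix.transpose_smul, Matrix.smul_mul, Matrix.smul_mul, Matrix.mul_smul, smul_smul,
      hU.1]
  have h4 : (s * s - 1) • J = 0 := by rw [sub_smul, one_smul, h3, sub_self]
  rcases smul_eq_zero.1 h4 with h | h
  · linear_combination h
  · exact absurd h (J_ne hD h1)

lemma good_exists (hD : Nrm D) (h1 : J * J' = 1) (h2 : J' * J = 1)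
    (hinv : ∀ g, D g * J * (D g)ᵀ = J)
    (hG : ∀ (g : G) (n : N), (D (MulAut.conjNormal g n)).trace = (D n).trace) (g : G) :
    ∃ T, Good N D J g T := by
  let E : N →* Matrix (Fin d) (Fin d) ℂ := D.comp (MulAut.conjNormal g : MulAut N).toMonoidHom
  have hEtr : ∀ n, (E n).trace = (D n).trace := hG g
  have hE : Nrm E := by simp only [Nrm, hEtr]; exact hD
  obtain ⟨T, hT, hi⟩ := exists_intertwiner E D (by
    simp only [hEtr]; rw [hD]; exact card_ne)
  obtain ⟨T', hT1, hT2⟩ := intertwiner_inv E D hE hD T hT hi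
  obtain ⟨c, hc⟩ := form_unique D hD (K := T * J * Tᵀ) h1 h2 hinv (fun m => by
    obtain ⟨n, rfl⟩ := (MulAut.conjNormal g : MulAut N).surjective m
    have hi' : D (MulAut.conjNormal g n) * T = T * D n := hi n
    calc D (MulAut.conjNormal g n) * (T * J * Tᵀ) * (D (MulAut.conjNormal g n))ᵀ
        = (D (MulAut.conjNormal g n) * T) * J * (D (MulAut.conjNormal g n) * T)ᵀ := by
          rw [Matrix.transpose_mul]; simp only [mul_assoc]
      _ = T * (D n * J * (D n)ᵀ) * Tᵀ := by
          rw [hi', Matrix.transpose_mul]; simp only [mul_assoc]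
      _ = _ := by rw [hinv])
  have hc0 : c ≠ 0 := by
    rintro rfl
    apply J_ne hD h1
    rw [zero_smul] at hc
    calc J = (T' * T) * J * (T' * T)ᵀ := by rw [hT2]; simp
      _ = T' * (T * J * Tᵀ) * T'ᵀ := by rw [Matrix.transpose_mul]; simp only [mul_assoc]
      _ = 0 := by rw [hc]; simp
  obtain ⟨μ, hμ⟩ := IsAlgClosed.exists_pow_nat_eq c⁻¹ (n := 2) (by norm_num)
  refine ⟨μ • T, ?_, fun n => ?_⟩
  · rw [Matrix.transpose_smul, Matrix.smul_mul, Matrix.smul_mul, Matrix.mul_smul, smul_smul, hc,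
      smul_smul, ← pow_two, hμ, inv_mul_cancel₀ hc0, one_smul]
  · rw [Matrix.smul_mul, Matrix.mul_smul]
    congr 1
    exact (hi n).symm

lemma section_exists (hD : Nrm D) (h1 : J * J' = 1) (h2 : J' * J = 1)
    (hinv : ∀ g, D g * J * (D g)ᵀ = J)
    (hG : ∀ (g : G) (n : N), (D (MulAut.conjNormal g n)).trace = (D n).trace) :
    ∃ T : G → Matrix (Fin d) (Fin d) ℂ, (∀ g, Good N D J g (T g)) ∧ (∀ n : N, T n = D n) ∧
      ∀ (n : N) (g : G), T (n * g) = D n * T g := by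
  have hτ : ∀ g : G, ∃ T, Good N D J g T ∧ ∀ h : g ∈ N, T = D ⟨g, h⟩ := by
    intro g
    by_cases h : g ∈ N
    · exact ⟨D ⟨g, h⟩, good_D hinv ⟨g, h⟩, fun _ => rfl⟩
    · obtain ⟨T, hT⟩ := good_exists hD h1 h2 hinv hG g
      exact ⟨T, hT, fun h' => absurd h' h⟩
  choose τ hτ hτN using hτ
  let r : G → G := fun g => (g : G ⧸ N).out
  have hr0 : ∀ g, (r g : G ⧸ N) = g := fun g => Quotient.out_eq _
  have hr : ∀ g, g * (r g)⁻¹ ∈ N := fun g => by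
    rw [← QuotientGroup.eq_one_iff, QuotientGroup.mk_mul, QuotientGroup.mk_inv, hr0,
      mul_inv_cancel]
  have hrn : ∀ (n : N) (g : G), r (n * g) = r g := fun n g => by
    have : ((n * g : G) : G ⧸ N) = g := by
      rw [QuotientGroup.mk_mul, (QuotientGroup.eq_one_iff _).2 n.2, one_mul]
    show ((n * g : G) : G ⧸ N).out = _
    rw [this]
  refine ⟨fun g => D ⟨g * (r g)⁻¹, hr g⟩ * τ (r g), fun g => ?_, fun n => ?_, fun n g => ?_⟩
  · have := (good_D hinv ⟨g * (r g)⁻¹, hr g⟩).mul (hτ (r g))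
    simpa using this
  · have hm : r n ∈ N := by
      have := N.mul_mem (N.inv_mem (hr n)) n.2
      simpa using this
    show D ⟨n * (r n)⁻¹, hr n⟩ * τ (r n) = D n
    rw [hτN _ hm, ← map_mul]
    congr 1
    ext
    simp
  · show D ⟨n * g * (r (n * g))⁻¹, hr _⟩ * τ (r (n * g)) = D n * (D ⟨g * (r g)⁻¹, hr g⟩ * τ (r g))
    rw [← mul_assoc, ← map_mul]
    congr 2
    · apply Subtype.ext
      show (n : G) * g * (r (n * g))⁻¹ = n * (g * (r g)⁻¹)
      rw [hrn, mul_assoc]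
    · rw [hrn]

lemma extension_exists (hodd : Odd N.index) (hD : Nrm D) (h1 : J * J' = 1) (h2 : J' * J = 1)
    (hinv : ∀ g, D g * J * (D g)ᵀ = J)
    (hG : ∀ (g : G) (n : N), (D (MulAut.conjNormal g n)).trace = (D n).trace) :
    ∃ S : G →* Matrix (Fin d) (Fin d) ℂ, (∀ n : N, S n = D n) ∧ ∀ g, S g * J * (S g)ᵀ = J := by
  obtain ⟨T, hT, hTN, hTn⟩ := section_exists hD h1 h2 hinv hG
  have hα : ∀ g h, ∃ s : ℂ, s * s = 1 ∧ T g * T h = s • T (g * h) := fun g h =>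
    good_unique hD h1 ((hT g).mul (hT h)) (hT (g * h))
  choose α hα1 hα2 using hα
  have cancel : ∀ (g : G) (a b : ℂ), a • T g = b • T g → a = b := fun g a b h =>
    smul_left_injective ℂ ((hT g).ne hD h1) h
  have hcoc : ∀ x y z, α x y * α (x * y) z = α y z * α x (y * z) := fun x y z => by
    apply cancel (x * y * z)
    have e1 : T x * T y * T z = (α x y * α (x * y) z) • T (x * y * z) := by
      rw [hα2, Matrix.smul_mul, hα2, smul_smul]
    have e2 : T x * (T y * T z) = (α y z * α x (y * z)) • T (x * y * z) := by
      rw [hα2, Matrix.mul_smul, hα2, smul_smul, mul_assoc x]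
    rw [← e1, ← e2, mul_assoc]
  have hα3 : ∀ (x : G) (m : N) (h : G), α x (m * h) = α x h := fun x m h => by
    apply cancel (x * (m * h))
    have e : x * (m * h) = (MulAut.conjNormal x m : N) * (x * h) := by
      simp [MulAut.conjNormal_apply, mul_assoc]
    rw [← hα2, hTn, ← mul_assoc, (hT x).2, mul_assoc, hα2, e, hTn, Matrix.mul_smul]
  have hα4 : ∀ (n : N) (h : G), α n h = 1 := fun n h => by
    apply cancel (n * h)
    rw [← hα2, hTN, hTn, one_smul]
  let c : G → ℂ := fun g => ∏ q : G ⧸ N, α g q.out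
  have hcN : ∀ n : N, c n = 1 := fun n => by simp [c, hα4]
  have hc2 : ∀ g, c g * c g = 1 := fun g => by
    simp only [c, ← Finset.prod_mul_distrib, hα1, Finset.prod_const_one]
  have hcard : Odd (Fintype.card (G ⧸ N)) := by
    rw [← Nat.card_eq_fintype_card]; exact hodd
  have hmul : ∀ x y, c (x * y) = c x * c y * α x y := fun x y => by
    have e1 : ∏ q : G ⧸ N, (α x y * α (x * y) q.out) = ∏ q : G ⧸ N, (α y q.out * α x (y * q.out)) :=
      Finset.prod_congr rfl fun q _ => hcoc _ _ _
    rw [Finset.prod_mul_distrib, Finset.prod_mul_distrib, Finset.prod_const, Finset.card_univ] at e1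
    have e2 : ∏ q : G ⧸ N, α x (y * q.out) = c x := by
      refine Fintype.prod_equiv (Equiv.mulLeft (y : G ⧸ N)) _ _ fun q => ?_
      have hm : (y * q.out) * ((y : G ⧸ N) * q).out⁻¹ ∈ N := by
        rw [← QuotientGroup.eq_one_iff, QuotientGroup.mk_mul, QuotientGroup.mk_inv,
          QuotientGroup.mk_mul, QuotientGroup.out_eq', QuotientGroup.out_eq', mul_inv_cancel]
      have := hα3 x ⟨_, hm⟩ ((y : G ⧸ N) * q).out
      rw [Equiv.coe_mulLeft, ← this]
      simp
    have e3 : α x y ^ Fintype.card (G ⧸ N) = α x y := by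
      obtain ⟨k, hk⟩ := hcard
      rw [hk, pow_succ, pow_mul, pow_two, hα1, one_pow, one_mul]
    rw [e2, e3] at e1
    have e4 : α x y * c (x * y) = c y * c x := e1
    linear_combination α x y * e4 - c (x * y) * hα1 x y
  refine ⟨{ toFun := fun g => c g • T g, map_one' := ?_, map_mul' := fun x y => ?_ },
    fun n => ?_, fun g => ((hT g).smul (hc2 g)).1⟩
  · have a := hcN 1
    have b := hTN 1
    simp only [OneMemClass.coe_one, map_one] at a b
    rw [a, b, one_smul]
  · rw [Matrix.smul_mul, Matrix.mul_smul, hα2, smul_smul, smul_smul, hmul]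
  · show c n • T n = D n
    rw [hcN, hTN, one_smul]

/-- restriction has norm one, hence so does the extension. -/
lemma nrm_ext (S : G →* Matrix (Fin d) (Fin d) ℂ) (hD : Nrm D) (hS : ∀ n : N, S n = D n) :
    Nrm S := by
  have hd := dim_ne D hD
  have key : ∀ g : G, ∑ n : N, (S (g * n)).trace * (S (g * n)⁻¹).trace = Fintype.card N := by
    intro g
    have h := congrArg (fun M => (M * S g⁻¹).trace) (schur_trace D hD (S g))
    simp only [Finset.sum_mul, Matrix.trace_sum, Matrix.smul_mul, Matrix.trace_smul, mul_inv_D,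
      Matrix.trace_one, Fintype.card_fin, smul_eq_mul, div_mul_cancel₀ _ hd] at h
    rw [← h]
    refine Finset.sum_congr rfl fun n _ => ?_
    rw [_root_.mul_inv_rev, map_mul, map_mul, hS, ← hS n⁻¹]
    rfl
  have h2 : ∑ g : G, ∑ n : N, (S (g * n)).trace * (S (g * n)⁻¹).trace
      = Fintype.card N * ∑ g : G, (S g).trace * (S g⁻¹).trace := by
    rw [Finset.sum_comm]
    have : ∀ n : N, ∑ g : G, (S (g * n)).trace * (S (g * n)⁻¹).trace =
        ∑ g : G, (S g).trace * (S g⁻¹).trace := fun n =>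
      Fintype.sum_equiv (Equiv.mulRight (n : G)) _ _ fun g => rfl
    simp only [this]
    rw [Finset.sum_const, Finset.card_univ, nsmul_eq_mul]
  simp only [key] at h2
  rw [Finset.sum_const, Finset.card_univ, nsmul_eq_mul, mul_comm] at h2
  exact (mul_left_cancel₀ card_ne h2).symm

lemma sum_quot (F : G ⧸ N → ℂ) : ∑ g : G, F g = Fintype.card N * ∑ q, F q := by
  rw [← (Subgroup.groupEquivQuotientProdSubgroup (s := N)).symm.sum_comp, Fintype.sum_prod_type,
    Finset.mul_sum]
  refine Finset.sum_congr rfl fun q _ => ?_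
  have : ∀ n : N, (((Subgroup.groupEquivQuotientProdSubgroup (s := N)).symm (q, n) : G) : G ⧸ N)
      = q := fun n => by
    have e : ∀ g : G, (Subgroup.groupEquivQuotientProdSubgroup (s := N) g).1 = (g : G ⧸ N) :=
      fun g => rfl
    rw [← e, Equiv.apply_symm_apply]
  simp [this]

lemma inner_ne (hodd : Odd N.index) (S : G →* Matrix (Fin d) (Fin d) ℂ) (hD : Nrm D)
    (hS : ∀ n : N, S n = D n) {ε : ℂ} (hε : ε * ε = 1) (hJT : Jᵀ = ε • J)
    (h1 : J * J' = 1) (hSJ : ∀ g, S g * J * (S g)ᵀ = J)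
    (W : G →* Matrix (Fin e) (Fin e) ℂ) (hW : Nrm W) (hWr : ∀ g, (W g⁻¹).trace = (W g).trace)
    (hSr : ∀ g, (S g⁻¹).trace = (S g).trace)
    (h : ∑ n : N, (W n).trace * (D n⁻¹).trace ≠ 0) :
    ∑ g : G, (W g).trace * (S g⁻¹).trace ≠ 0 := by
  have hcG := card_ne (G := G)
  have hcN := card_ne (G := N)
  have he := dim_ne W hW
  -- the linear map Φ
  obtain ⟨f, hf0, hf⟩ := exists_intertwiner (W.comp N.subtype) D h
  obtain ⟨L, hL⟩ := exists_trace_ne hf0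
  let k : ℂ := Fintype.card G / e * (f * L).trace
  have hk : k ≠ 0 := by simp [k, hL, he]
  let Φ : Matrix (Fin d) (Fin d) ℂ →ₗ[ℂ] Matrix (Fin e) (Fin e) ℂ :=
    { toFun := fun X => k⁻¹ • ∑ g : G, W g * (f * (S g⁻¹ * X * S g) * L) * W g⁻¹
      map_add' := fun X Y => by
        simp only [Matrix.mul_add, Matrix.add_mul, Finset.sum_add_distrib, smul_add]
      map_smul' := fun c X => by
        simp only [Matrix.mul_smul, Matrix.smul_mul, ← Finset.smul_sum, RingHom.id_apply]
        rw [smul_comm] }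
  have hΦ : ∀ n : N, W n = Φ (S n) := by
    intro n
    have e1 : W n * ∑ g : G, W g * (f * L) * W g⁻¹ = k • W n := by
      rw [schur_sum W hW, Matrix.mul_smul, mul_one]
    show W n = k⁻¹ • ∑ g : G, W g * (f * (S g⁻¹ * S n * S g) * L) * W g⁻¹
    rw [eq_inv_smul_iff₀ hk, ← e1, Finset.mul_sum]
    refine Finset.sum_congr rfl fun g _ => ?_
    have hm : g⁻¹ * n * g ∈ N := by
      have := Subgroup.Normal.conj_mem (inferInstance : N.Normal) n n.2 g⁻¹
      simpa using this
    have hf' : W (g⁻¹ * n * g) * f = f * S (g⁻¹ * n * g) := by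
      have := hf ⟨_, hm⟩
      rw [← hS] at this
      exact this
    have e2 : (n : G) * g = g * (g⁻¹ * n * g) := by group
    calc W n * (W g * (f * L) * W g⁻¹) = W (n * g) * f * L * W g⁻¹ := by
          rw [map_mul]; simp only [Matrix.mul_assoc]
      _ = W g * (W (g⁻¹ * n * g) * f) * L * W g⁻¹ := by
          rw [e2, map_mul]; simp only [Matrix.mul_assoc]
      _ = _ := by
          rw [hf', map_mul, map_mul]; simp only [Matrix.mul_assoc]
  have hz : ∀ g : G, ∑ n : N, S (g⁻¹ * n * g * n) =
      (ε * (Fintype.card N / d) : ℂ) • (S g⁻¹ * S g⁻¹) := by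
    intro g
    have e1 := sum_DAD D hD hε hJT h1 (fun n => by rw [← hS]; exact hSJ n) (S g)
    have e2 : J * (S g)ᵀ * J' = S g⁻¹ := by
      calc J * (S g)ᵀ * J' = S g⁻¹ * (S g * J * (S g)ᵀ) * J' := by
            rw [mul_assoc (S g), ← mul_assoc (S g⁻¹), inv_mul_D, one_mul]
        _ = _ := by rw [hSJ, mul_assoc, h1, mul_one]
    rw [e2] at e1
    rw [← Matrix.mul_smul, ← e1, Finset.mul_sum]
    refine Finset.sum_congr rfl fun n _ => ?_
    rw [map_mul, map_mul, map_mul, hS]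
    simp only [mul_assoc]
  have hy : ∀ g : G, ∑ n : N, (S (g * g * n)).trace • S n =
      (Fintype.card N / d : ℂ) • (S g⁻¹ * S g⁻¹) := by
    intro g
    rw [← schur_trace D hD]
    refine Fintype.sum_equiv (Equiv.inv N) _ _ fun n => ?_
    simp only [Equiv.inv_apply, inv_inv]
    rw [← hSr, hS, _root_.mul_inv_rev, _root_.mul_inv_rev, map_mul, map_mul,
      Matrix.trace_mul_comm, ← hS n⁻¹]
    rfl
  have hzy : ∀ g : G, ∑ n : N, W (g⁻¹ * n * g * n) =
      ε • ∑ n : N, (S (g * g * n)).trace • W n := by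
    intro g
    have e1 : ∑ n : N, S (g⁻¹ * n * g * n) = ε • ∑ n : N, (S (g * g * n)).trace • S n := by
      rw [hz, hy, smul_smul]
    have e2 := congrArg Φ e1
    rw [map_sum, map_smul, map_sum] at e2
    simp only [map_smul, ← hΦ] at e2
    rw [← e2]
    refine Finset.sum_congr rfl fun n _ => ?_
    have hm : g⁻¹ * n * g * n ∈ N := by
      have := Subgroup.Normal.conj_mem (inferInstance : N.Normal) n n.2 g⁻¹
      exact N.mul_mem (by simpa using this) n.2
    exact hΦ ⟨_, hm⟩
  have hgow : ∀ g : G, ∑ n : N, (W ((g * n) * (g * n))).trace =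
      ε * ∑ n : N, (S (g * g * n)).trace * (W (g * g * n)).trace := by
    intro g
    have e1 := congrArg (fun M => (W (g * g) * M).trace) (hzy g)
    simp only [Matrix.mul_smul, Matrix.trace_smul, Finset.mul_sum, Matrix.trace_sum, ← map_mul,
      smul_eq_mul] at e1
    rw [Finset.mul_sum]
    rw [← e1]
    refine Finset.sum_congr rfl fun n _ => ?_
    have e2 : g * n * (g * n) = g * n * g * n := by group
    have e3 : g * g * (g⁻¹ * n * g * n) = g * n * g * n := by group
    rw [e2, e3]
  -- the class function on the quotient
  have hF : ∀ a b : G, (a : G ⧸ N) = b →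
      ∑ n : N, (S (a * n)).trace * (W (a * n)).trace =
        ∑ n : N, (S (b * n)).trace * (W (b * n)).trace := by
    intro a b hab
    have hm := QuotientGroup.eq.1 hab
    refine Fintype.sum_equiv (Equiv.mulLeft (⟨_, hm⟩ : N)⁻¹) _ _ fun n => ?_
    have : b * ((⟨a⁻¹ * b, hm⟩ : N)⁻¹ * n : N) = a * n := by
      simp [mul_assoc]
    rw [Equiv.coe_mulLeft, this]
  let F : G ⧸ N → ℂ := fun q => ∑ n : N, (S (q.out * n)).trace * (W (q.out * n)).trace
  have hF2 : ∀ a : G, F a = ∑ n : N, (S (a * n)).trace * (W (a * n)).trace := fun a =>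
    hF _ _ (QuotientGroup.out_eq' _)
  have hsq : ∑ g : G, F ((g * g : G) : G ⧸ N) = ∑ g : G, F g := by
    have hbij : Function.Bijective fun q : G ⧸ N => q ^ 2 := by
      apply Nat.Coprime.pow_left_bijective
      exact Nat.Coprime.symm ((Nat.coprime_two_left).2 hodd)
    have e1 := sum_quot (N := N) (fun q => F (q ^ 2))
    rw [hbij.sum_comp F, ← sum_quot] at e1
    rw [← e1]
    refine Finset.sum_congr rfl fun g _ => ?_
    rw [pow_two, QuotientGroup.mk_mul]
  have hL1 : ∑ g : G, ∑ n : N, (W ((g * n) * (g * n))).trace =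
      Fintype.card N * ∑ g : G, (W (g * g)).trace := by
    rw [Finset.sum_comm]
    have : ∀ n : N, ∑ g : G, (W ((g * n) * (g * n))).trace = ∑ g : G, (W (g * g)).trace := fun n =>
      Fintype.sum_equiv (Equiv.mulRight (n : G)) _ _ fun g => rfl
    simp only [this]
    rw [Finset.sum_const, Finset.card_univ, nsmul_eq_mul]
  have hL2 : ∑ g : G, F g = Fintype.card N * ∑ g : G, (W g).trace * (S g⁻¹).trace := by
    simp only [hF2]
    rw [Finset.sum_comm]
    have : ∀ n : N, ∑ g : G, (S (g * n)).trace * (W (g * n)).trace =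
        ∑ g : G, (W g).trace * (S g⁻¹).trace := fun n =>
      Fintype.sum_equiv (Equiv.mulRight (n : G)) _ _ fun g => by
        rw [hSr, mul_comm]; rfl
    simp only [this]
    rw [Finset.sum_const, Finset.card_univ, nsmul_eq_mul]
  intro h0
  rw [h0, mul_zero] at hL2
  rw [hL2] at hsq
  simp only [hgow, ← hF2, ← Finset.mul_sum] at hL1
  rw [hsq, mul_zero] at hL1
  exact frobenius_schur W hW hWr ((mul_eq_zero.1 hL1.symm).resolve_left hcN)

end

end Richards

/-- Richards: if `|G/N|` is odd and `θ ∈ Irr(N)` is real and `G`-invariant,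
there is a unique real irreducible character of `G` over `θ`, and it extends `θ`. -/
theorem stmt7 {G : Type*} [Group G] [Fintype G] (N : Subgroup G) [N.Normal]
    (hodd : Odd N.index) (θ : ↥N → ℂ) (hθ : IsIrrChar ↥N θ)
    (hreal : IsRealChar ↥N θ) (hinv : ∀ g : G, conjChar N θ g = θ) :
    ∃ χ : G → ℂ,
      (IsIrrChar G χ ∧ IsRealChar G χ ∧ innerChar N (fun n => χ ↑n) θ ≠ 0 ∧
        ∀ n : ↥N, χ ↑n = θ n) ∧
      ∀ χ' : G → ℂ, IsIrrChar G χ' → IsRealChar G χ' →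
        innerChar N (fun n => χ' ↑n) θ ≠ 0 → χ' = χ := by
  classical
  obtain ⟨⟨d, D, hχ⟩, hn⟩ := And.imp_left (Richards.isChar_iff θ).1 hθ
  have hconj : ∀ n : N, (D n⁻¹).trace = (D n).trace := fun n => by
    rw [Richards.trace_inv, ← hχ, hreal]
  have hD : Richards.Nrm D := by
    rw [Richards.Nrm, ← hn]
    refine Finset.sum_congr rfl fun n _ => ?_
    rw [Richards.trace_inv, hχ]
  have hG : ∀ (g : G) (n : N), (D (MulAut.conjNormal g n)).trace = (D n).trace := fun g n => by
    rw [← hχ, ← hχ]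
    have h := congrFun (hinv g) n
    have hm : g * n * g⁻¹ ∈ N := Subgroup.Normal.conj_mem (inferInstance : N.Normal) n n.2 g
    rw [conjChar, ext0, dif_pos hm] at h
    exact h
  obtain ⟨J, J', ε, hε, hJT, h1, h2, hJ⟩ := Richards.exists_form D hD hconj
  obtain ⟨S, hS, hSJ⟩ := Richards.extension_exists hodd hD h1 h2 hJ hG
  have hSn : Richards.Nrm S := Richards.nrm_ext S hD hS
  have hSr : ∀ g, (S g⁻¹).trace = (S g).trace := fun g => by
    have e2 : J * (S g)ᵀ * J' = S g⁻¹ := by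
      calc J * (S g)ᵀ * J' = S g⁻¹ * (S g * J * (S g)ᵀ) * J' := by
            rw [mul_assoc (S g), ← mul_assoc (S g⁻¹), Richards.inv_mul_D, one_mul]
        _ = _ := by rw [hSJ, mul_assoc, h1, mul_one]
    rw [← e2, Matrix.trace_mul_comm, ← mul_assoc, h2, one_mul, Matrix.trace_transpose]
  refine ⟨fun g => (S g).trace, ⟨⟨(Richards.isChar_iff _).2 ⟨d, S, fun _ => rfl⟩, ?_⟩,
    fun g => ?_, ?_, fun n => ?_⟩, ?_⟩
  · rw [← hSn]
    refine Finset.sum_congr rfl fun g _ => ?_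
    rw [Richards.trace_inv]
  · rw [← Richards.trace_inv, hSr]
  · have : ∀ n : N, (S n).trace = θ n := fun n => by rw [hS, hχ]
    simp only [innerChar, this]
    rw [hn]
    simp
  · show (S n).trace = θ n
    rw [hS, hχ]
  · intro χ' hχ' hr' hin
    obtain ⟨⟨e, W, hW⟩, hn'⟩ := And.imp_left (Richards.isChar_iff χ').1 hχ'
    have hWn : Richards.Nrm W := by
      rw [Richards.Nrm, ← hn']
      refine Finset.sum_congr rfl fun g _ => ?_
      rw [Richards.trace_inv, hW]
    have hWr : ∀ g, (W g⁻¹).trace = (W g).trace := fun g => by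
      rw [Richards.trace_inv, ← hW, hr']
    have hne : ∑ n : N, (W n).trace * (D n⁻¹).trace ≠ 0 := by
      intro h0
      apply hin
      rw [innerChar]
      have : ∑ n : N, χ' n * (starRingEnd ℂ) (θ n) = 0 := by
        rw [← h0]
        refine Finset.sum_congr rfl fun n _ => ?_
        rw [Richards.trace_inv, hχ, hW]
      rw [this, zero_div]
    have hfin := Richards.inner_ne hodd S hD hS hε hJT h1 hSJ W hWn hWr hSr hne
    funext g
    rw [hW]
    exact Richards.char_eq_of_ne W S hWn hSn hfin g
end

section
/- Let N be a normal subgroup of a finite group G with [G:N] odd, and let θ be a real-valued G-invariant irreducible character of N. Then for every irreducible character χ of G lying over θ, the multiplicity ⟨χ↓_N, θ⟩ is odd. -/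
open scoped Classical

section Helpers

open Representation

open scoped ComplexOrder in
theorem trace_conj_aux {H : Type*} [Group H] [Fintype H] {n : ℕ}
    (ρ : Representation ℂ H (Fin n → ℂ)) (g : H) :
    (starRingEnd ℂ) (ρ.character g) = ρ.character g⁻¹ := by
  let A : H → Matrix (Fin n) (Fin n) ℂ := fun h => LinearMap.toMatrix' (ρ h)
  have hmul : ∀ x y, A (x * y) = A x * A y := fun x y => by
    simp [A, LinearMap.toMatrix'_mul]
  have hone : A 1 = 1 := by simp [A]
  have htr : ∀ x, ρ.character x = (A x).trace := fun x => by
    simp only [A, Representation.character]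
    rw [LinearMap.trace_eq_matrix_trace ℂ (Pi.basisFun ℂ (Fin n))]
    rfl
  let P : Matrix (Fin n) (Fin n) ℂ := ∑ h : H, (A h).conjTranspose * A h
  have hpd : P.PosDef := by
    have h1 : P = 1 + ∑ h ∈ Finset.univ.erase (1 : H), (A h).conjTranspose * A h := by
      simp only [P]
      rw [← Finset.add_sum_erase _ _ (Finset.mem_univ (1 : H)), hone]
      simp
    rw [h1]
    refine Matrix.PosDef.one.add_posSemidef ?_
    exact Matrix.posSemidef_sum _ fun h _ => Matrix.posSemidef_conjTranspose_mul_self _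
  have hinv : (A g).conjTranspose * P * A g = P := by
    simp only [P, Finset.mul_sum, Finset.sum_mul]
    refine Fintype.sum_equiv (Equiv.mulRight g) _ _ fun h => ?_
    simp [hmul, Matrix.conjTranspose_mul, Matrix.mul_assoc]
  have hg : A g * A g⁻¹ = 1 := by rw [← hmul, mul_inv_cancel, hone]
  have hU : IsUnit P.det := (Matrix.isUnit_iff_isUnit_det P).1 hpd.isUnit
  have h2 : (A g).conjTranspose = P * A g⁻¹ * P⁻¹ := by
    have : (A g).conjTranspose * P = P * A g⁻¹ := by
      calc (A g).conjTranspose * P = (A g).conjTranspose * P * (A g * A g⁻¹) := by rw [hg, mul_one]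
        _ = ((A g).conjTranspose * P * A g) * A g⁻¹ := by simp only [Matrix.mul_assoc]
        _ = _ := by rw [hinv]
    rw [← this, Matrix.mul_nonsing_inv_cancel_right _ _ hU]
  rw [htr, htr, starRingEnd_apply, ← Matrix.trace_conjTranspose, h2, Matrix.trace_mul_comm,
    ← Matrix.mul_assoc, Matrix.nonsing_inv_mul _ hU, one_mul]

theorem comp_sum_aux {ι V : Type*} [AddCommGroup V] [Module ℂ V] (s : Finset ι)
    (f : V →ₗ[ℂ] V) (F : ι → V →ₗ[ℂ] V) : f ∘ₗ (∑ i ∈ s, F i) = ∑ i ∈ s, f ∘ₗ F i := by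
  ext x; simp

theorem sum_comp_aux {ι V : Type*} [AddCommGroup V] [Module ℂ V] (s : Finset ι)
    (f : V →ₗ[ℂ] V) (F : ι → V →ₗ[ℂ] V) : (∑ i ∈ s, F i) ∘ₗ f = ∑ i ∈ s, F i ∘ₗ f := by
  ext x; simp

theorem trace_integral_aux {H V : Type*} [Group H] [Fintype H] [AddCommGroup V] [Module ℂ V]
    [FiniteDimensional ℂ V] (ρ : Representation ℂ H V) (g : H) :
    IsIntegral ℤ (ρ.character g) := by
  rw [Representation.character,
    Module.End.trace_eq_sum_roots_charpoly_of_splits (IsAlgClosed.splits _)]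
  refine IsIntegral.multiset_sum fun x hx => ?_
  have hx' : Module.End.HasEigenvalue (ρ g) x := by
    rw [Module.End.hasEigenvalue_iff_isRoot_charpoly]
    exact (Polynomial.mem_roots'.1 hx).2
  obtain ⟨v, hv⟩ := hx'.exists_hasEigenvector
  have h1 := hv.pow_apply (Fintype.card H)
  rw [← map_pow, pow_card_eq_one, map_one, Module.End.one_apply] at h1
  have h2 : x ^ Fintype.card H = 1 := by
    have : (x ^ Fintype.card H - 1) • v = 0 := by rw [sub_smul, ← h1, one_smul, sub_self]
    rcases smul_eq_zero.1 this with h | h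
    · exact sub_eq_zero.1 h
    · exact absurd h hv.2
  exact IsIntegral.of_pow Fintype.card_pos (h2 ▸ isIntegral_one)

theorem schur_aux {H V : Type*} [Group H] [Fintype H] [AddCommGroup V] [Module ℂ V]
    [FiniteDimensional ℂ V] (ρ : Representation ℂ H V)
    (hn : ∑ g : H, ρ.character g * ρ.character g⁻¹ = (Fintype.card H : ℂ))
    (f : V →ₗ[ℂ] V) (hf : ∀ g, f ∘ₗ ρ g = ρ g ∘ₗ f) : ∃ c : ℂ, f = c • LinearMap.id := by
  have hne : (Nat.card H : ℂ) ≠ 0 := by exact_mod_cast Nat.card_pos.ne'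
  let : Invertible (Nat.card H : ℂ) := invertibleOfNonzero hne
  have h := card_inv_mul_sum_char_mul_char_eq_finrank ρ ρ
  rw [hn, ← Nat.card_eq_fintype_card, inv_mul_cancel₀ hne] at h
  have h1 : Module.finrank ℂ (IntertwiningMap ρ ρ) = 1 := by exact_mod_cast h.symm
  let I : IntertwiningMap ρ ρ := ⟨LinearMap.id, fun g => by simp⟩
  have hI : I ≠ 0 := by
    intro h0
    have h00 : (LinearMap.id : V →ₗ[ℂ] V) = 0 := congrArg IntertwiningMap.toLinearMap h0
    have hs : Subsingleton V := ⟨fun a b => by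
      have ha := LinearMap.congr_fun h00 a
      have hb := LinearMap.congr_fun h00 b
      simp at ha hb
      rw [ha, hb]⟩
    have : Subsingleton (IntertwiningMap ρ ρ) := ⟨fun a b => by
      ext x; exact Subsingleton.elim _ _⟩
    rw [Module.finrank_zero_of_subsingleton] at h1
    exact absurd h1 (by norm_num)
  obtain ⟨c, hc⟩ := (finrank_eq_one_iff_of_nonzero' I hI).1 h1 ⟨f, hf⟩
  exact ⟨c, (congrArg IntertwiningMap.toLinearMap hc).symm⟩

theorem trace_inv_aux {G V : Type*} [Group G] [Fintype G] [AddCommGroup V] [Module ℂ V]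
    [FiniteDimensional ℂ V] (ρ : Representation ℂ G V) (N : Subgroup G) [N.Normal] (g : G) :
    (ρ.quotientToInvariants N).character (g : G ⧸ N) =
      (∑ n : N, ρ.character (g * n)) / (Nat.card N : ℂ) := by
  have hne : (Fintype.card N : ℂ) ≠ 0 := by exact_mod_cast Fintype.card_pos.ne'
  let : Invertible (Fintype.card N : ℂ) := invertibleOfNonzero hne
  let σ : Representation ℂ N V := ρ.comp N.subtype
  let p := invariants σ
  have hp := isProj_averageMap σ
  let h : V →ₗ[ℂ] p := (ρ.toInvariants N g) ∘ₗ (LinearMap.codRestrict p (averageMap σ) hp.1)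
  have e1 : h ∘ₗ p.subtype = ρ.toInvariants N g := by
    ext x
    simp only [h, LinearMap.comp_apply]
    congr 2
    exact Subtype.ext (hp.2 x x.2)
  have e2 : p.subtype ∘ₗ h = ρ g ∘ₗ averageMap σ := by
    ext x; rfl
  have e3 : (ρ.quotientToInvariants N).character (g : G ⧸ N)
      = LinearMap.trace ℂ p (ρ.toInvariants N g) := rfl
  rw [e3, ← e1, LinearMap.trace_comp_comm', e2]
  simp only [averageMap, GroupAlgebra.average, map_smul, map_sum, LinearMap.comp_smul,
    comp_sum_aux, Representation.asAlgebraHom_of]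
  rw [div_eq_inv_mul, Nat.card_eq_fintype_card, invOf_eq_inv, smul_eq_mul]
  congr 1
  refine Finset.sum_congr rfl fun n _ => ?_
  rw [Representation.character, map_mul]
  rfl

theorem parity_aux {Q : Type*} [Group Q] [Fintype Q] (hQ : Odd (Fintype.card Q)) (a : Q → ℂ)
    (hint : ∀ q, IsIntegral ℤ (a q)) (hinv : ∀ q, a q⁻¹ = a q)
    (hsum : ∑ q, a q = (Fintype.card Q : ℂ)) (m : ℕ) (hm : a 1 = (m : ℂ)) : Odd m := by
  let R := integralClosure ℤ ℂ
  let b : Q → R := fun q => ⟨a q, hint q⟩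
  let I : Ideal R := Ideal.span {2}
  have h2 : (Ideal.Quotient.mk I) 2 = 0 :=
    Ideal.Quotient.eq_zero_iff_mem.2 (Ideal.subset_span rfl)
  have hz : ∑ q ∈ Finset.univ.erase (1 : Q), (Ideal.Quotient.mk I) (b q) = 0 := by
    refine Finset.sum_involution (fun q _ => q⁻¹) ?_ ?_ ?_ ?_
    · intro q _
      have : b q⁻¹ = b q := Subtype.ext (hinv q)
      rw [this, ← two_mul, ← map_ofNat (Ideal.Quotient.mk I) 2, h2, zero_mul]
    · intro q hq _ h
      have hq1 : q ≠ 1 := (Finset.mem_erase.1 hq).1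
      have hqq : q ^ 2 = 1 := by
        rw [sq]; nth_rewrite 1 [← h]; exact inv_mul_cancel q
      have hord : orderOf q ∣ 2 := orderOf_dvd_of_pow_eq_one hqq
      have hord2 : orderOf q ∣ Fintype.card Q := orderOf_dvd_card
      have : orderOf q ∣ 1 := by
        have hc : Nat.Coprime 2 (Fintype.card Q) := (Nat.coprime_two_left).2 hQ
        rw [← hc]; exact Nat.dvd_gcd hord hord2
      exact hq1 (orderOf_eq_one_iff.1 (Nat.dvd_one.1 this))
    · intro q hq
      simpa using hq
    · intro q _; exact inv_inv q
  rw [← map_sum, Ideal.Quotient.eq_zero_iff_mem, Ideal.mem_span_singleton'] at hz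
  obtain ⟨r, hr⟩ := hz
  have hr' : (r : ℂ) * 2 = (Fintype.card Q : ℂ) - m := by
    have := congrArg (fun x : R => (x : ℂ)) hr
    simp only [b] at this
    push_cast at this
    rw [← hsum, ← hm, ← Finset.add_sum_erase _ _ (Finset.mem_univ (1 : Q)), add_sub_cancel_left]
    exact this
  have hrQ : (r : ℂ) = algebraMap ℚ ℂ (((Fintype.card Q : ℚ) - m) / 2) := by
    have : (r : ℂ) = ((Fintype.card Q : ℂ) - m) / 2 := by rw [← hr']; simp
    rw [this]; simp
  have hri : IsIntegral ℤ (((Fintype.card Q : ℚ) - m) / 2) := by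
    have := r.2
    rw [hrQ] at this
    exact (isIntegral_algebraMap_iff (algebraMap ℚ ℂ).injective).1 this
  obtain ⟨z, hz⟩ := IsIntegrallyClosed.isIntegral_iff.1 hri
  have hz' : (Fintype.card Q : ℤ) - m = 2 * z := by
    have : (Fintype.card Q : ℚ) - m = 2 * z := by
      rw [eq_div_iff two_ne_zero] at hz
      rw [← hz]; simp [mul_comm]
    exact_mod_cast this
  obtain ⟨k, hk⟩ := hQ
  rw [← Nat.not_even_iff_odd]
  rintro ⟨l, hl⟩
  omega

/-- Clifford-type proportionality. -/
theorem clifford_aux {G V W : Type*} [Group G] [Fintype G] [AddCommGroup V] [Module ℂ V]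
    [FiniteDimensional ℂ V] [AddCommGroup W] [Module ℂ W] [FiniteDimensional ℂ W]
    (N : Subgroup G) [N.Normal]
    (ρ : Representation ℂ G V) (σ : Representation ℂ N W)
    (hρ : ∑ g : G, ρ.character g * ρ.character g⁻¹ = (Fintype.card G : ℂ))
    (hσ : ∑ g : N, σ.character g * σ.character g⁻¹ = (Fintype.card N : ℂ))
    (hinv : ∀ (g : G) (n : N), σ.character (MulAut.conjNormal g n) = σ.character n)
    (hover : ∑ n : N, ρ.character n * σ.character n⁻¹ ≠ 0) :
    ∃ c : ℂ, ∀ n : N, ρ.character n = c * σ.character n := by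
  obtain ⟨c, hc⟩ := schur_aux ρ hρ (∑ n : N, σ.character n⁻¹ • ρ n) (by
    intro g
    simp only [sum_comp_aux, comp_sum_aux, LinearMap.smul_comp, LinearMap.comp_smul]
    symm
    refine Fintype.sum_equiv (MulAut.conjNormal g).toEquiv _ _ fun n => ?_
    simp only [MulEquiv.toEquiv_eq_coe, EquivLike.coe_coe]
    rw [← map_inv, hinv, ← Module.End.mul_eq_comp, ← Module.End.mul_eq_comp, ← map_mul, ← map_mul]
    simp)
  obtain ⟨d, hd⟩ := schur_aux σ hσ (∑ n : N, ρ.character n • σ n⁻¹) (by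
    intro g
    simp only [sum_comp_aux, comp_sum_aux, LinearMap.smul_comp, LinearMap.comp_smul]
    symm
    refine Fintype.sum_equiv (MulAut.conj g).toEquiv _ _ fun n => ?_
    have h1 : ((MulAut.conj g).toEquiv n)⁻¹ * g = g * n⁻¹ := by simp [mul_assoc]
    have h2 : ρ.character (((MulAut.conj g).toEquiv n : N) : G) = ρ.character n :=
      ρ.char_conj (n : G) (g : G)
    rw [← Module.End.mul_eq_comp, ← Module.End.mul_eq_comp, ← map_mul, ← map_mul, h1, h2])
  have hc0 : c ≠ 0 := by
    rintro rfl
    have := congrArg (LinearMap.trace ℂ V) hc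
    rw [zero_smul, map_zero, map_sum] at this
    apply hover
    rw [← this]
    refine Finset.sum_congr rfl fun n _ => ?_
    rw [map_smul, smul_eq_mul, mul_comm]; rfl
  refine ⟨d / c, fun n => ?_⟩
  have e1 : c * ρ.character n = ∑ m : N, σ.character m⁻¹ * ρ.character (m * n : G) := by
    have := congrArg (fun f => LinearMap.trace ℂ V (f ∘ₗ ρ n)) hc
    simp only [sum_comp_aux, LinearMap.smul_comp, map_sum, map_smul, smul_eq_mul,
      LinearMap.id_comp] at this
    rw [Representation.character, ← this]
    refine Finset.sum_congr rfl fun m _ => ?_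
    rw [← Module.End.mul_eq_comp, ← map_mul]; rfl
  have e2 : d * σ.character n = ∑ m : N, ρ.character m * σ.character (m⁻¹ * n) := by
    have := congrArg (fun f => LinearMap.trace ℂ W (f ∘ₗ σ n)) hd
    simp only [sum_comp_aux, LinearMap.smul_comp, map_sum, map_smul, smul_eq_mul,
      LinearMap.id_comp] at this
    rw [Representation.character, ← this]
    refine Finset.sum_congr rfl fun m _ => ?_
    rw [← Module.End.mul_eq_comp, ← map_mul]; rfl
  have e3 : c * ρ.character n = d * σ.character n := by
    rw [e1, e2]
    refine Fintype.sum_equiv (Equiv.mulRight n) _ _ fun m => ?_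
    have : σ.character ((m * n)⁻¹ * n) = σ.character m⁻¹ := by
      rw [mul_inv_rev, Representation.char_mul_comm, mul_inv_cancel_left]
    simp only [Equiv.coe_mulRight]
    rw [this, mul_comm]; rfl
  rw [div_mul_eq_mul_div, ← e3, mul_div_cancel_left₀ _ hc0]

/-- The norm of the restriction to a normal subgroup of odd index is odd. -/
theorem norm_odd_aux {G V : Type*} [Group G] [Fintype G] [AddCommGroup V] [Module ℂ V]
    [FiniteDimensional ℂ V] (N : Subgroup G) [N.Normal] (hodd : Odd N.index)
    (ρ : Representation ℂ G V)
    (hρ : ∑ g : G, ρ.character g * ρ.character g⁻¹ = (Fintype.card G : ℂ)) (m : ℕ)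
    (hm : ∑ n : N, ρ.character n * ρ.character n⁻¹ = (m : ℂ) * (Nat.card N : ℂ)) : Odd m := by
  have hne : (Nat.card N : ℂ) ≠ 0 := by exact_mod_cast Nat.card_pos.ne'
  let a : G ⧸ N → ℂ := ((linHom ρ ρ).quotientToInvariants N).character
  have ha : ∀ g : G, a (g : G ⧸ N) =
      (∑ n : N, ρ.character (g * n) * ρ.character (g * n)⁻¹) / (Nat.card N : ℂ) := by
    intro g
    simp only [a]
    rw [trace_inv_aux]
    simp only [char_linHom, mul_comm]
  refine parity_aux (Q := G ⧸ N) ?_ a (fun q => trace_integral_aux _ q) ?_ ?_ m ?_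
  · rwa [← Nat.card_eq_fintype_card]
  · intro q
    obtain ⟨g, rfl⟩ := QuotientGroup.mk_surjective q
    rw [← QuotientGroup.mk_inv, ha, ha]
    congr 1
    refine Fintype.sum_equiv ((Equiv.inv N).trans (MulAut.conjNormal g⁻¹).toEquiv) _ _ fun n => ?_
    have : (g * ((((Equiv.inv N).trans (MulAut.conjNormal g⁻¹).toEquiv) n : N) : G)) =
      (n : G)⁻¹ * g := by
      simp [mul_assoc]
    rw [this, mul_inv_rev, mul_inv_rev, inv_inv, inv_inv, mul_comm]
  · have h1 : ∑ g : G, a (g : G ⧸ N) = (Fintype.card G : ℂ) := by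
      simp only [ha]
      rw [← Finset.sum_div, Finset.sum_comm]
      have : ∀ n : N, ∑ g : G, ρ.character (g * n) * ρ.character (g * n)⁻¹
          = (Fintype.card G : ℂ) := fun n => by
        rw [← hρ]
        exact Fintype.sum_equiv (Equiv.mulRight (n : G)) _ _ fun g => rfl
      simp only [this, Finset.sum_const, Finset.card_univ, nsmul_eq_mul]
      rw [← Nat.card_eq_fintype_card (α := N), mul_div_cancel_left₀ _ hne]
    have h2 : ∑ g : G, a (g : G ⧸ N) = (Nat.card N : ℂ) * ∑ q, a q := by
      have hmk : ∀ x : (G ⧸ N) × N, ((x.1.out * (x.2 : G) : G) : G ⧸ N) = x.1 := fun x => by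
        rw [QuotientGroup.mk_mul_of_mem _ x.2.2]; exact QuotientGroup.out_eq' x.1
      have hb : Function.Bijective (fun x : (G ⧸ N) × N => x.1.out * (x.2 : G)) := by
        constructor
        · intro x y hxy
          have h1 : x.1 = y.1 := by
            rw [← hmk x, ← hmk y]; exact congrArg _ hxy
          simp only [h1] at hxy
          exact Prod.ext h1 (Subtype.ext (mul_left_cancel hxy))
        · intro g
          refine ⟨((g : G ⧸ N), ⟨(g : G ⧸ N).out⁻¹ * g, ?_⟩), by simp⟩
          exact QuotientGroup.eq.1 (QuotientGroup.out_eq' _)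
      rw [← Fintype.sum_bijective _ hb (fun x => a x.1) _ (fun x => by rw [hmk])]
      rw [Fintype.sum_prod_type, Finset.mul_sum]
      simp
    have h3 : (Fintype.card G : ℂ) = (Nat.card N : ℂ) * (Fintype.card (G ⧸ N) : ℂ) := by
      rw [← Nat.card_eq_fintype_card, ← Nat.card_eq_fintype_card, mul_comm]
      exact_mod_cast Subgroup.card_eq_card_quotient_mul_card_subgroup N
    exact mul_left_cancel₀ hne (by rw [← h2, h1, h3])
  · have := ha 1
    rw [QuotientGroup.mk_one] at this
    rw [this, div_eq_iff hne, ← hm]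
    simp

end Helpers

/-- if `[G:N]` is odd and `θ ∈ Irr(N)` is real and `G`-invariant, then every
`χ ∈ Irr(G | θ)` has odd multiplicity `⟨χ↓N, θ⟩`. -/
theorem stmt8 {G : Type*} [Group G] [Fintype G] (N : Subgroup G) [N.Normal]
    (hodd : Odd N.index) (θ : ↥N → ℂ) (hθ : IsIrrChar ↥N θ)
    (hreal : IsRealChar ↥N θ) (hinv : ∀ g : G, conjChar N θ g = θ)
    (χ : G → ℂ) (hχ : IsIrrChar G χ) (hover : innerChar N (fun n => χ ↑n) θ ≠ 0) :
    ∃ m : ℕ, Odd m ∧ innerChar N (fun n => χ ↑n) θ = (m : ℂ) := by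
  obtain ⟨⟨n, ρ, hρ⟩, hχn⟩ := hχ
  obtain ⟨⟨k, σ, hσ⟩, hθn⟩ := hθ
  have hχ' : ∀ g, χ g = ρ.character g := hρ
  have hθ' : ∀ g, θ g = σ.character g := hσ
  have hne : (Nat.card N : ℂ) ≠ 0 := by exact_mod_cast Nat.card_pos.ne'
  have hρ1 : ∑ g : G, ρ.character g * ρ.character g⁻¹ = (Fintype.card G : ℂ) := by
    rw [← hχn]
    exact Finset.sum_congr rfl fun g _ => by rw [hχ', trace_conj_aux]
  have hσ1 : ∑ g : N, σ.character g * σ.character g⁻¹ = (Fintype.card N : ℂ) := by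
    rw [← hθn]
    exact Finset.sum_congr rfl fun g _ => by rw [hθ', trace_conj_aux]
  have hin : innerChar N (fun n => χ ↑n) θ =
      (∑ h : N, ρ.character (h : G) * σ.character h⁻¹) / (Nat.card N : ℂ) := by
    unfold innerChar
    congr 1
    exact Finset.sum_congr rfl fun g _ => by simp only [hχ', hθ', trace_conj_aux]
  have hinv' : ∀ (g : G) (n : N), σ.character (MulAut.conjNormal g n) = σ.character n := by
    intro g n
    have h := congrFun (hinv g) n
    have hmem : g * (n : G) * g⁻¹ ∈ N := (inferInstance : N.Normal).conj_mem _ n.2 g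
    rw [conjChar, ext0, dif_pos hmem] at h
    rw [← hθ', ← hθ', ← h]
    congr 1
  rw [hin] at hover
  obtain ⟨c, hc⟩ := clifford_aux N ρ σ hρ1 hσ1 hinv' fun h => hover (by rw [h, zero_div])
  let : Invertible (Nat.card N : ℂ) := invertibleOfNonzero hne
  have hfin := Representation.card_inv_mul_sum_char_mul_char_eq_finrank σ
    (ρ.comp N.subtype : Representation ℂ N (Fin n → ℂ))
  set m := Module.finrank ℂ (Representation.IntertwiningMap σ
    (ρ.comp N.subtype : Representation ℂ N (Fin n → ℂ)))
  have hm : innerChar N (fun n => χ ↑n) θ = (m : ℂ) := by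
    rw [hin, ← hfin, div_eq_inv_mul]; rfl
  have hcm : c = m := by
    rw [← hm, hin]
    simp only [hc, mul_assoc]
    rw [← Finset.mul_sum, hσ1, ← Nat.card_eq_fintype_card, mul_div_cancel_right₀ _ hne]
  refine ⟨m, ?_, hm⟩
  have hodd2 : Odd (m * m) := by
    refine norm_odd_aux N hodd ρ hρ1 (m * m) ?_
    have : ∀ h : N, ρ.character (h : G) * ρ.character (h : G)⁻¹
        = (m * m : ℂ) * (σ.character h * σ.character h⁻¹) := fun h => by
      have h2 := hc h⁻¹
      rw [Subgroup.coe_inv] at h2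
      rw [hc, h2, hcm]; ring
    simp only [this]
    rw [← Finset.mul_sum, hσ1, ← Nat.card_eq_fintype_card]
    push_cast; ring
  exact (Nat.odd_mul.1 hodd2).1
end

section
/- Let N be a normal subgroup of a finite group G, θ ∈ Irr(N), and suppose χ ∈ Irr(G) lies over θ with ⟨χ↓_N, θ⟩ odd and χ real-valued. If θ is real-valued and G-invariant and Ω(G,N) = N (i.e. every g ∈ G with g² ∈ N lies in N), then ε(χ) = ε(θ), where ε denotes the Frobenius–Schur indicator. -/
open scoped Classical

namespace FSProof

open Matrix
open scoped ComplexOrder Classical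

set_option linter.unusedSectionVars false

variable {H : Type*} [Group H] [Fintype H] {n k : ℕ}

/-- intertwiners from `S` to `R`. -/
def Hom (R : H →* Matrix (Fin n) (Fin n) ℂ) (S : H →* Matrix (Fin k) (Fin k) ℂ) :
    Submodule ℂ (Matrix (Fin n) (Fin k) ℂ) where
  carrier := {X | ∀ h, R h * X = X * S h}
  add_mem' := by
    intro a b ha hb h
    rw [Matrix.mul_add, Matrix.add_mul, ha h, hb h]
  zero_mem' := by intro h; simp
  smul_mem' := by
    intro c x hx h
    rw [Matrix.mul_smul, Matrix.smul_mul, hx h]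

/-- two-sided multiplication -/
def lr (A : Matrix (Fin n) (Fin n) ℂ) (B : Matrix (Fin k) (Fin k) ℂ) :
    Matrix (Fin n) (Fin k) ℂ →ₗ[ℂ] Matrix (Fin n) (Fin k) ℂ where
  toFun X := A * X * B
  map_add' := by intro x y; rw [Matrix.mul_add, Matrix.add_mul]
  map_smul' := by intro c x; simp

/-- transpose as a linear map -/
def tr : Matrix (Fin n) (Fin n) ℂ →ₗ[ℂ] Matrix (Fin n) (Fin n) ℂ where
  toFun X := Xᵀ
  map_add' := by intro x y; simp
  map_smul' := by intro c x; simp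

lemma trace_mat (f : Matrix (Fin n) (Fin k) ℂ →ₗ[ℂ] Matrix (Fin n) (Fin k) ℂ) :
    LinearMap.trace ℂ _ f = ∑ i, ∑ j, f (Matrix.single i j 1) i j := by
  rw [LinearMap.trace_eq_matrix_trace ℂ (Matrix.stdBasis ℂ (Fin n) (Fin k)), Matrix.trace,
    Fintype.sum_prod_type]
  refine Finset.sum_congr rfl fun i _ => Finset.sum_congr rfl fun j _ => ?_
  rw [Matrix.diag_apply, LinearMap.toMatrix_apply, Matrix.stdBasis_eq_single]
  rfl

lemma sandwich {a b c d : ℕ} (A : Matrix (Fin a) (Fin b) ℂ) (B : Matrix (Fin c) (Fin d) ℂ) (i j p q) :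
    (A * Matrix.single i j (1:ℂ) * B) p q = A p i * B j q := by
  rw [Matrix.mul_apply, Finset.sum_eq_single j]
  · simp
  · intro x _ hx
    simp [Matrix.mul_single_apply_of_ne, hx]
  · simp

lemma trace_lr (A : Matrix (Fin n) (Fin n) ℂ) (B : Matrix (Fin k) (Fin k) ℂ) :
    LinearMap.trace ℂ _ (lr A B) = A.trace * B.trace := by
  rw [trace_mat, Matrix.trace, Matrix.trace, Finset.sum_mul_sum]
  refine Finset.sum_congr rfl fun i _ => Finset.sum_congr rfl fun j _ => ?_
  exact sandwich A B i j i j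

lemma trace_lr_tr (A B : Matrix (Fin n) (Fin n) ℂ) :
    LinearMap.trace ℂ _ (lr A B ∘ₗ tr) = (A * Bᵀ).trace := by
  rw [trace_mat, Matrix.trace]
  refine Finset.sum_congr rfl fun i _ => ?_
  rw [Matrix.diag_apply, Matrix.mul_apply]
  refine Finset.sum_congr rfl fun j _ => ?_
  have : (lr A B ∘ₗ tr) (Matrix.single i j 1) = A * Matrix.single j i (1:ℂ) * B := by
    change A * (Matrix.single i j (1:ℂ))ᵀ * B = _
    rw [Matrix.transpose_single]
  rw [this, sandwich]
  rfl

/-- averaging -/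
noncomputable def avg (R : H →* Matrix (Fin n) (Fin n) ℂ) (S : H →* Matrix (Fin k) (Fin k) ℂ) :
    Matrix (Fin n) (Fin k) ℂ →ₗ[ℂ] Matrix (Fin n) (Fin k) ℂ :=
  (Fintype.card H : ℂ)⁻¹ • ∑ h : H, lr (R h) (S h⁻¹)

lemma avg_apply (R : H →* Matrix (Fin n) (Fin n) ℂ) (S : H →* Matrix (Fin k) (Fin k) ℂ) (X) :
    avg R S X = (Fintype.card H : ℂ)⁻¹ • ∑ h : H, R h * X * S h⁻¹ := by
  simp [avg, lr]

lemma mulinv (S : H →* Matrix (Fin k) (Fin k) ℂ) (h : H) : S h * S h⁻¹ = 1 := by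
  rw [← map_mul]; simp

lemma invmul (S : H →* Matrix (Fin k) (Fin k) ℂ) (h : H) : S h⁻¹ * S h = 1 := by
  rw [← map_mul]; simp

lemma card_ne : (Fintype.card H : ℂ) ≠ 0 := by
  exact_mod_cast Fintype.card_ne_zero

lemma isProj_avg (R : H →* Matrix (Fin n) (Fin n) ℂ) (S : H →* Matrix (Fin k) (Fin k) ℂ) :
    LinearMap.IsProj (Hom R S) (avg R S) := by
  constructor
  · intro X g
    rw [avg_apply, Matrix.mul_smul, Matrix.smul_mul, Matrix.mul_sum, Matrix.sum_mul]
    congr 1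
    refine Fintype.sum_equiv (Equiv.mulLeft g) _ _ fun h => ?_
    simp only [Equiv.coe_mulLeft, _root_.mul_inv_rev, map_mul, Matrix.mul_assoc, invmul, Matrix.mul_one]
  · intro X hX
    rw [avg_apply]
    have : ∀ h : H, R h * X * S h⁻¹ = X := by
      intro h
      rw [hX h, Matrix.mul_assoc, mulinv, Matrix.mul_one]
    rw [Finset.sum_congr rfl fun h _ => this h, Finset.sum_const, Finset.card_univ,
      ← Nat.cast_smul_eq_nsmul ℂ, smul_smul, inv_mul_cancel₀ card_ne, one_smul]

lemma finrank_Hom (R : H →* Matrix (Fin n) (Fin n) ℂ) (S : H →* Matrix (Fin k) (Fin k) ℂ) :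
    (Module.finrank ℂ (Hom R S) : ℂ) =
      (Fintype.card H : ℂ)⁻¹ * ∑ h : H, (R h).trace * (S h⁻¹).trace := by
  rw [← (isProj_avg R S).trace, avg, map_smul, map_sum, smul_eq_mul]
  simp only [trace_lr]

/-- contragredient -/
def dual (R : H →* Matrix (Fin n) (Fin n) ℂ) : H →* Matrix (Fin n) (Fin n) ℂ where
  toFun h := (R h⁻¹)ᵀ
  map_one' := by simp
  map_mul' := by intro a b; simp

lemma mem_form {R : H →* Matrix (Fin n) (Fin n) ℂ} {X} :
    X ∈ Hom (dual R) R ↔ ∀ h, (R h)ᵀ * X * R h = X := by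
  constructor
  · intro hX h
    have := hX h⁻¹
    simp only [dual, MonoidHom.coe_mk, OneHom.coe_mk, inv_inv] at this
    rw [this, Matrix.mul_assoc, invmul, Matrix.mul_one]
  · intro hX h
    simp only [dual, MonoidHom.coe_mk, OneHom.coe_mk]
    conv_rhs => rw [← hX h⁻¹]
    rw [Matrix.mul_assoc, Matrix.mul_assoc, invmul, Matrix.mul_one]

lemma trace_inv (R : H →* Matrix (Fin n) (Fin n) ℂ) (g : H) :
    (R g⁻¹).trace = (starRingEnd ℂ) (R g).trace := by
  set P : Matrix (Fin n) (Fin n) ℂ := ∑ h : H, (R h)ᴴ * R h with hP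
  have hpos : P.PosDef := by
    have h1 : P = (∑ h ∈ Finset.univ.erase (1:H), (R h)ᴴ * R h) + 1 := by
      rw [hP, ← Finset.sum_erase_add _ _ (Finset.mem_univ (1:H))]
      simp
    rw [h1]
    refine Matrix.PosDef.posSemidef_add ?_ Matrix.PosDef.one
    exact Matrix.posSemidef_sum _ fun h _ => Matrix.posSemidef_conjTranspose_mul_self _
  have hinv : (R g)ᴴ * P * R g = P := by
    rw [hP, Matrix.mul_sum, Matrix.sum_mul]
    refine Fintype.sum_equiv (Equiv.mulRight g) _ _ fun h => ?_
    simp [Matrix.mul_assoc]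
  have hu : IsUnit P.det := (Matrix.isUnit_iff_isUnit_det _).1 hpos.isUnit
  have : R g⁻¹ = P⁻¹ * ((R g)ᴴ * P) := by
    have h2 : (R g)ᴴ * P = P * R g⁻¹ := by
      conv_rhs => rw [← hinv]
      rw [Matrix.mul_assoc, Matrix.mul_assoc, mulinv, Matrix.mul_one]
    rw [h2, ← Matrix.mul_assoc, Matrix.nonsing_inv_mul _ hu, Matrix.one_mul]
  rw [this, Matrix.trace_mul_comm, Matrix.mul_assoc, Matrix.mul_nonsing_inv _ hu, Matrix.mul_one,
    Matrix.trace_conjTranspose]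
  rfl

lemma trace_self_ne {W : Matrix (Fin k) (Fin n) ℂ} (hW : W ≠ 0) : (W * Wᴴ).trace ≠ 0 := by
  intro h
  exact hW (Matrix.trace_mul_conjTranspose_self_eq_zero_iff.1 h)

/-- A nonzero intertwiner `V → U` composes with some intertwiner `U → V` with nonzero trace. -/
lemma exists_pair (R : H →* Matrix (Fin n) (Fin n) ℂ) (S : H →* Matrix (Fin k) (Fin k) ℂ)
    (W : Matrix (Fin k) (Fin n) ℂ) (hW : W ∈ Hom S R) (h0 : W ≠ 0) :
    ∃ Y ∈ Hom R S, (W * Y).trace ≠ 0 := by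
  refine ⟨avg R S Wᴴ, (isProj_avg R S).map_mem _, ?_⟩
  have : (W * avg R S Wᴴ).trace = (W * Wᴴ).trace := by
    rw [avg_apply, Matrix.mul_smul, Matrix.trace_smul, Matrix.mul_sum, Matrix.trace_sum]
    have : ∀ h : H, (W * (R h * Wᴴ * S h⁻¹)).trace = (W * Wᴴ).trace := by
      intro h
      rw [← Matrix.mul_assoc, ← Matrix.mul_assoc, Matrix.trace_mul_comm, ← Matrix.mul_assoc,
        ← hW h, ← Matrix.mul_assoc, invmul, Matrix.one_mul]
    rw [Finset.sum_congr rfl fun h _ => this h, Finset.sum_const, Finset.card_univ,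
      ← Nat.cast_smul_eq_nsmul ℂ, smul_smul, inv_mul_cancel₀ card_ne, one_smul]
  rw [this]
  exact trace_self_ne h0

lemma form_exists (R : H →* Matrix (Fin n) (Fin n) ℂ) (χ : H → ℂ) (hR : ∀ h, χ h = (R h).trace)
    (hreal : IsRealChar H χ)
    (hn : ∑ g : H, χ g * (starRingEnd ℂ) (χ g) = (Fintype.card H : ℂ)) :
    ∃ B : Matrix (Fin n) (Fin n) ℂ, IsUnit B.det ∧ B ∈ Hom (dual R) R ∧
      (∀ X ∈ Hom (dual R) R, ∃ c : ℂ, c • B = X) ∧ Bᵀ = FSind H χ • B ∧ B ≠ 0 := by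
  have hinvt : ∀ h, (R h⁻¹).trace = χ h := by
    intro h; rw [trace_inv, ← hR, hreal]
  have hend : Module.finrank ℂ (Hom R R) = 1 := by
    have := finrank_Hom R R
    rw [Finset.sum_congr rfl (g := fun g => χ g * (starRingEnd ℂ) (χ g)) (fun g _ => by
      rw [hinvt, hreal, ← hR]), hn, inv_mul_cancel₀ card_ne] at this
    exact_mod_cast this
  have hform : Module.finrank ℂ (Hom (dual R) R) = 1 := by
    have := finrank_Hom (dual R) R
    rw [Finset.sum_congr rfl (g := fun g => χ g * (starRingEnd ℂ) (χ g)) (fun g _ => by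
      simp only [dual, MonoidHom.coe_mk, OneHom.coe_mk, Matrix.trace_transpose]
      rw [hinvt, hreal]), hn, inv_mul_cancel₀ card_ne] at this
    exact_mod_cast this
  obtain ⟨⟨B, hB⟩, hB0, hBs⟩ := finrank_eq_one_iff'.1 hform
  have hB0' : B ≠ 0 := fun h => hB0 (Subtype.ext h)
  have hspan : ∀ X ∈ Hom (dual R) R, ∃ c : ℂ, c • B = X := by
    intro X hX
    obtain ⟨c, hc⟩ := hBs ⟨X, hX⟩
    exact ⟨c, congrArg Subtype.val hc⟩
  have h1 : (1 : Matrix (Fin n) (Fin n) ℂ) ∈ Hom R R := by intro h; simp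
  have hne1 : (1 : Matrix (Fin n) (Fin n) ℂ) ≠ 0 := by
    intro h
    apply hB0'
    rw [← Matrix.mul_one B, h, Matrix.mul_zero]
  refine ⟨B, ?_, hB, hspan, ?_, hB0'⟩
  · obtain ⟨Y, hY, hYt⟩ := exists_pair R (dual R) B hB hB0'
    have hYB : Y * B ∈ Hom R R := by
      intro h
      rw [← Matrix.mul_assoc, hY h, Matrix.mul_assoc, hB h, Matrix.mul_assoc]
    obtain ⟨c, hc⟩ := (finrank_eq_one_iff_of_nonzero' (⟨1, h1⟩ : Hom R R)
      (fun h => hne1 (congrArg Subtype.val h))).1 hend ⟨Y * B, hYB⟩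
    have hc' : c • (1 : Matrix (Fin n) (Fin n) ℂ) = Y * B := congrArg Subtype.val hc
    have hc0 : c ≠ 0 := by
      rintro rfl
      rw [Matrix.trace_mul_comm, ← hc'] at hYt
      simp at hYt
    have : (c⁻¹ • Y) * B = 1 := by
      rw [Matrix.smul_mul, ← hc', smul_smul, inv_mul_cancel₀ hc0, one_smul]
    exact Matrix.isUnit_det_of_left_inverse this
  · have htm : ∀ X ∈ Hom (dual R) R, Xᵀ ∈ Hom (dual R) R := by
      intro X hX
      rw [mem_form] at hX ⊢
      intro h
      have := congrArg Matrix.transpose (hX h)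
      simpa [Matrix.mul_assoc] using this
    obtain ⟨c, hc⟩ := hspan _ (htm B hB)
    have hcomp : avg (dual R) R ∘ₗ tr = c • avg (dual R) R := by
      refine LinearMap.ext fun X => ?_
      obtain ⟨l, hl⟩ := hspan _ ((isProj_avg (dual R) R).map_mem X)
      have : avg (dual R) R Xᵀ = (avg (dual R) R X)ᵀ := by
        rw [avg_apply, avg_apply, Matrix.transpose_smul, Matrix.transpose_sum]
        congr 1
        refine Finset.sum_congr rfl fun h _ => ?_
        simp [dual, Matrix.mul_assoc]
      change avg (dual R) R Xᵀ = c • avg (dual R) R X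
      rw [this, ← hl, Matrix.transpose_smul, ← hc, smul_comm]
    have ht := congrArg (LinearMap.trace ℂ _) hcomp
    rw [map_smul, (isProj_avg (dual R) R).trace, hform, avg, LinearMap.smul_comp,
      show (∑ h : H, lr (dual R h) (R h⁻¹)) ∘ₗ tr = ∑ h : H, lr (dual R h) (R h⁻¹) ∘ₗ tr from by
        refine LinearMap.ext fun X => ?_
        simp, map_smul, map_sum] at ht
    simp only [trace_lr_tr] at ht
    have hs : ∑ h : H, ((dual R) h * (R h⁻¹)ᵀ).trace = ∑ h : H, χ (h ^ 2) := by
      refine Fintype.sum_equiv (Equiv.inv H) _ _ fun h => ?_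
      simp only [dual, MonoidHom.coe_mk, OneHom.coe_mk, Equiv.inv_apply]
      rw [hR, ← Matrix.transpose_mul, Matrix.trace_transpose, ← map_mul, pow_two]
    rw [hs] at ht
    rw [← hc, FSind, div_eq_inv_mul]
    congr 1
    simpa using ht.symm

lemma exists_matrix {χ : H → ℂ} (h : IsChar H χ) :
    ∃ (n : ℕ) (R : H →* Matrix (Fin n) (Fin n) ℂ), ∀ h, χ h = (R h).trace := by
  obtain ⟨n, ρ, hρ⟩ := h
  refine ⟨n, ((LinearMap.toMatrixAlgEquiv' (R := ℂ) (n := Fin n)) : _ →* _).comp ρ, fun h => ?_⟩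
  rw [hρ, LinearMap.trace_eq_matrix_trace ℂ (Pi.basisFun ℂ (Fin n))]
  rfl

end FSProof

open FSProof Matrix in
/-- with `θ` real `G`-invariant, `Ω(G,N) = N`, and `χ` real over `θ` with
odd multiplicity, the Frobenius–Schur indicators agree: `ε(χ) = ε(θ)`. -/
theorem stmt9 {G : Type*} [Group G] [Fintype G] (N : Subgroup G) [N.Normal]
    (θ : ↥N → ℂ) (hθ : IsIrrChar ↥N θ) (hreal : IsRealChar ↥N θ)
    (hinv : ∀ g : G, conjChar N θ g = θ)
    (hOmega : ∀ g : G, g ^ 2 ∈ N → g ∈ N)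
    (χ : G → ℂ) (hχ : IsIrrChar G χ) (hχreal : IsRealChar G χ)
    (hmult : ∃ m : ℕ, Odd m ∧ innerChar N (fun n => χ ↑n) θ = (m : ℂ)) :
    FSind G χ = FSind ↥N θ := by
  obtain ⟨n, R, hR⟩ := exists_matrix hχ.1
  obtain ⟨k, S, hS⟩ := exists_matrix hθ.1
  obtain ⟨B, hBu, hB, -, hBt, hB0⟩ := form_exists R χ hR hχreal hχ.2
  obtain ⟨b, hbu, hb, hbs, hbt, hb0⟩ := form_exists S θ hS hreal hθ.2
  obtain ⟨m, hm, hmi⟩ := hmult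
  set e := FSind G χ
  set f := FSind N θ
  have hee : e * e = 1 := by
    have h1 := congrArg Matrix.transpose hBt
    rw [Matrix.transpose_transpose, Matrix.transpose_smul, hBt, smul_smul] at h1
    by_contra hne
    have h2 : (e * e - 1) • B = 0 := by rw [sub_smul, one_smul, ← h1, sub_self]
    exact (smul_eq_zero.1 h2).elim (fun h => hne (sub_eq_zero.1 h)) hB0
  have hff : f * f = 1 := by
    have h1 := congrArg Matrix.transpose hbt
    rw [Matrix.transpose_transpose, Matrix.transpose_smul, hbt, smul_smul] at h1
    by_contra hne
    have h2 : (f * f - 1) • b = 0 := by rw [sub_smul, one_smul, ← h1, sub_self]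
    exact (smul_eq_zero.1 h2).elim (fun h => hne (sub_eq_zero.1 h)) hb0
  by_contra hef
  have hef1 : e * f = -1 := by
    have h1 : (e - f) * (e + f) = 0 := by linear_combination hee - hff
    rcases mul_eq_zero.1 h1 with h | h
    · exact absurd (sub_eq_zero.1 h) hef
    · have : e = -f := eq_neg_of_add_eq_zero_left h
      rw [this]; linear_combination -hff
  set Q : N →* Matrix (Fin n) (Fin n) ℂ := R.comp N.subtype with hQ
  have hBQ : ∀ h : N, (Q h)ᵀ * B * Q h = B := fun h => mem_form.1 hB h
  have hdim : Module.finrank ℂ (Hom Q S) = m := by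
    have h1 := finrank_Hom Q S
    have h2 : (Module.finrank ℂ (Hom Q S) : ℂ) = m := by
      rw [h1, ← hmi, innerChar, div_eq_inv_mul, Nat.card_eq_fintype_card]
      congr 1
      refine Finset.sum_congr rfl fun h _ => ?_
      rw [trace_inv, ← hS, hR]
      rfl
    exact_mod_cast h2
  have hmem : ∀ X ∈ Hom Q S, ∀ Y ∈ Hom Q S, Xᵀ * B * Y ∈ Hom (dual S) S := by
    intro X hX Y hY
    rw [mem_form]
    intro h
    calc (S h)ᵀ * (Xᵀ * B * Y) * S h = (X * S h)ᵀ * B * (Y * S h) := by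
          simp [Matrix.mul_assoc]
      _ = Xᵀ * ((Q h)ᵀ * B * Q h) * Y := by
          rw [← hX h, ← hY h]; simp [Matrix.mul_assoc]
      _ = _ := by rw [hBQ]
  let v := Module.finBasisOfFinrankEq ℂ (Hom Q S) hdim
  have hex : ∀ i j, ∃ c : ℂ, c • b = (v i).1ᵀ * B * (v j).1 :=
    fun i j => hbs _ (hmem _ (v i).2 _ (v j).2)
  choose γ hγ using hex
  have hskew : ∀ i j, γ j i = - γ i j := by
    intro i j
    have h1 : γ j i • b = (e * f * γ i j) • b := by
      have h2 : ((v j).1ᵀ * B * (v i).1) = ((v i).1ᵀ * Bᵀ * (v j).1)ᵀ := by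
        simp [Matrix.mul_assoc]
      rw [hγ j i, h2, hBt, Matrix.mul_smul, Matrix.smul_mul, ← hγ i j, smul_smul,
        Matrix.transpose_smul, hbt, smul_smul]
      congr 1; ring
    have h3 := smul_left_injective ℂ hb0 h1
    rw [h3, hef1]; ring
  have hdet : (Matrix.of γ).det = 0 := by
    have h1 : (Matrix.of γ)ᵀ = - Matrix.of γ := by
      ext i j; exact hskew i j
    have h2 := Matrix.det_transpose (Matrix.of γ)
    rw [h1, Matrix.det_neg, Fintype.card_fin, hm.neg_one_pow] at h2
    linear_combination (-1/2) * h2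
  obtain ⟨w, hw0, hw⟩ := Matrix.exists_vecMul_eq_zero_iff.2 hdet
  set X : Hom Q S := ∑ i, w i • v i with hX
  have hX0 : X ≠ 0 := by
    intro h
    apply hw0
    funext i
    exact Fintype.linearIndependent_iff.1 v.linearIndependent w h i
  have hXc : X.1 = ∑ i, w i • (v i).1 := by
    rw [hX]; simp
  have hXj : ∀ j, X.1ᵀ * B * (v j).1 = 0 := by
    intro j
    rw [hXc, Matrix.transpose_sum, Matrix.sum_mul, Matrix.sum_mul]
    have : ∀ i, (w i • (v i).1)ᵀ * B * (v j).1 = (w i * γ i j) • b := by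
      intro i
      rw [Matrix.transpose_smul, Matrix.smul_mul, Matrix.smul_mul, ← hγ, smul_smul]
    rw [Finset.sum_congr rfl fun i _ => this i, ← Finset.sum_smul]
    have h2 := congrFun hw j
    simp only [Matrix.vecMul, dotProduct, Matrix.of_apply, Pi.zero_apply] at h2
    rw [h2, zero_smul]
  have hXY : ∀ Y ∈ Hom Q S, X.1ᵀ * B * Y = 0 := by
    intro Y hY
    have h1 := congrArg Subtype.val (v.sum_repr ⟨Y, hY⟩)
    simp only [Submodule.coe_sum, Submodule.coe_smul] at h1
    rw [← h1, Matrix.mul_sum]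
    refine Finset.sum_eq_zero fun j _ => ?_
    rw [Matrix.mul_smul, hXj, smul_zero]
  have hWmem : X.1ᵀ * B ∈ Hom (dual S) Q := by
    intro h
    change (S h⁻¹)ᵀ * (X.1ᵀ * B) = X.1ᵀ * B * Q h
    have h1 : (S h⁻¹)ᵀ * X.1ᵀ = X.1ᵀ * (Q h⁻¹)ᵀ := by
      rw [← Matrix.transpose_mul, ← X.2 h⁻¹, Matrix.transpose_mul]
    have h2 : (Q h⁻¹)ᵀ * B = B * Q h := by
      conv_rhs => rw [← hBQ h⁻¹]
      rw [Matrix.mul_assoc, Matrix.mul_assoc, invmul, Matrix.mul_one]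
    rw [← Matrix.mul_assoc, h1, Matrix.mul_assoc, h2, Matrix.mul_assoc]
  have hW0 : b⁻¹ * (X.1ᵀ * B) ≠ 0 := by
    intro h
    apply hX0
    have h1 : X.1ᵀ = b * (b⁻¹ * (X.1ᵀ * B)) * B⁻¹ := by
      rw [← Matrix.mul_assoc b, Matrix.mul_nonsing_inv _ hbu, Matrix.one_mul, Matrix.mul_assoc,
        Matrix.mul_nonsing_inv _ hBu, Matrix.mul_one]
    rw [h, Matrix.mul_zero, Matrix.zero_mul] at h1
    exact Subtype.ext (Matrix.transpose_eq_zero.1 h1)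
  have hWm : b⁻¹ * (X.1ᵀ * B) ∈ Hom S Q := by
    intro h
    have h1 : S h * b⁻¹ = b⁻¹ * dual S h := by
      have h2 := hb h
      calc S h * b⁻¹ = b⁻¹ * (b * S h) * b⁻¹ := by
            rw [← Matrix.mul_assoc, Matrix.nonsing_inv_mul _ hbu, Matrix.one_mul]
        _ = _ := by
            rw [← h2, Matrix.mul_assoc, Matrix.mul_assoc, Matrix.mul_nonsing_inv _ hbu,
              Matrix.mul_one]
    rw [← Matrix.mul_assoc, h1, Matrix.mul_assoc, hWmem h, ← Matrix.mul_assoc]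
  obtain ⟨Y, hY, hYt⟩ := exists_pair Q S _ hWm hW0
  apply hYt
  rw [Matrix.mul_assoc, hXY Y hY, Matrix.mul_zero, Matrix.trace_zero]
end

section
/- Let N ⊴ G and let θ ∈ Irr(N) have 2-defect zero (|N|/θ(1) is odd) and be real-valued. Let t ∈ G \ N with t² ∈ N and θ^t = θ. Then both extensions of θ to N⟨t⟩ are real-valued; equivalently ε_t(θ) = +1. -/
open scoped Classical

abbrev Mt (n : ℕ) := Matrix (Fin n) (Fin n) ℂ

/-- the commutant consists of scalars -/
def ScalComm {H : Type*} [Group H] {n : ℕ} (ρ : H →* Mt n) : Prop :=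
  ∀ X : Mt n, (∀ h, X * ρ h = ρ h * X) → ∃ c : ℂ, X = c • (1 : Mt n)

lemma scalComm_of_norm {H : Type*} [Group H] [Fintype H] {n : ℕ} (ρ : H →* Mt n)
    (hχ : ∑ h : H, (ρ h).trace * (ρ h⁻¹).trace = (Nat.card H : ℂ)) : ScalComm ρ := by
  let r : Representation ℂ H (Fin n → ℂ) :=
    ((Matrix.toLinAlgEquiv' : Mt n ≃ₐ[ℂ] _) : Mt n →* _).comp ρ
  have hr : ∀ h, r h = Matrix.toLin' (ρ h) := fun h => rfl
  have hch : ∀ h, r.character h = (ρ h).trace := by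
    intro h
    rw [Representation.character, hr, Matrix.trace_toLin'_eq]
  have hc : (Nat.card H : ℂ) ≠ 0 := by exact_mod_cast Nat.card_pos.ne'
  have := invertibleOfNonzero hc
  have h1 := Representation.card_inv_mul_sum_char_mul_char_eq_finrank r r
  simp only [hch] at h1
  rw [hχ, inv_mul_cancel₀ hc] at h1
  have h2 : Module.finrank ℂ (Representation.IntertwiningMap r r) = 1 := by
    exact_mod_cast h1.symm
  have hne : Representation.IntertwiningMap.id r ≠ 0 := by
    intro h0
    have hsub : Subsingleton (Representation.IntertwiningMap r r) := by
      refine ⟨fun a b => ?_⟩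
      apply Representation.IntertwiningMap.ext
      refine LinearMap.ext fun v => ?_
      have h3 : (Representation.IntertwiningMap.id r).toLinearMap
        = (0 : Representation.IntertwiningMap r r).toLinearMap := by rw [h0]
      have hv : ∀ v : Fin n → ℂ, v = 0 := fun v => by
        simpa using congrArg (fun f => f v) h3
      rw [hv (a.toLinearMap _), hv (b.toLinearMap _)]
    rw [Module.finrank_zero_of_subsingleton] at h2
    exact absurd h2 (by norm_num)
  intro X hX
  let f : Representation.IntertwiningMap r r :=
    ⟨Matrix.toLin' X, fun h => by
      rw [hr, ← Matrix.toLin'_mul, hX h, Matrix.toLin'_mul]⟩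
  obtain ⟨c, hc⟩ := (finrank_eq_one_iff_of_nonzero' _ hne).mp h2 f
  refine ⟨c, ?_⟩
  have h4 : (c • Representation.IntertwiningMap.id r).toLinearMap = f.toLinearMap := by rw [hc]
  have h5 : c • LinearMap.id = Matrix.toLin' X := h4
  apply Matrix.toLin'.injective
  rw [← h5, map_smul, Matrix.toLin'_one]

lemma schur_avg {H : Type*} [Group H] [Fintype H] {n : ℕ} (ρ : H →* Mt n) (hn : (n : ℂ) ≠ 0)
    (hs : ScalComm ρ) (X : Mt n) :
    ∑ h : H, ρ h * X * ρ h⁻¹ = ((Nat.card H : ℂ) * X.trace / n) • (1 : Mt n) := by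
  obtain ⟨c, hc⟩ := hs (∑ h : H, ρ h * X * ρ h⁻¹) (by
    intro k
    rw [Finset.sum_mul, Finset.mul_sum]
    refine Fintype.sum_equiv (Equiv.mulLeft k⁻¹) _ _ fun h => ?_
    simp only [Equiv.coe_mulLeft, mul_inv_rev, inv_inv, map_mul]
    rw [← mul_assoc, ← mul_assoc, ← mul_assoc, ← mul_assoc, ← map_mul ρ k k⁻¹]
    simp)
  rw [hc]
  congr 1
  have h1 := congrArg Matrix.trace hc
  rw [Matrix.trace_sum, Matrix.trace_smul, Matrix.trace_one, Fintype.card_fin] at h1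
  have h2 : ∀ h : H, (ρ h * X * ρ h⁻¹).trace = X.trace := by
    intro h
    rw [Matrix.trace_mul_comm, ← mul_assoc, ← map_mul]
    simp
  simp only [h2, Finset.sum_const, Finset.card_univ, nsmul_eq_mul, smul_eq_mul] at h1
  rw [Nat.card_eq_fintype_card, h1]
  field_simp

lemma schur_entries {H : Type*} [Group H] [Fintype H] {n : ℕ} (ρ : H →* Mt n) (hn : (n : ℂ) ≠ 0)
    (hs : ScalComm ρ) (A A' : Mt n) (hA : A * A' = 1) (i j k l : Fin n) :
    ∑ h : H, (ρ h * A) i j * (A' * ρ h⁻¹) k l =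
      if i = l ∧ j = k then (Nat.card H : ℂ) / n else 0 := by
  have h := congrFun (congrFun (schur_avg ρ hn hs (A * Matrix.single j k 1 * A')) i) l
  have htr : (A * Matrix.single j k (1 : ℂ) * A').trace = if j = k then 1 else 0 := by
    rw [Matrix.trace_mul_comm, ← mul_assoc, mul_eq_one_comm.mp hA, one_mul]
    by_cases hjk : j = k
    · subst hjk; simp
    · simp [hjk]
  rw [htr, Matrix.sum_apply] at h
  have h2 : ∀ x : H, (ρ x * (A * Matrix.single j k (1 : ℂ) * A') * ρ x⁻¹) i l
      = (ρ x * A) i j * (A' * ρ x⁻¹) k l := by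
    intro x
    have : ρ x * (A * Matrix.single j k (1 : ℂ) * A') * ρ x⁻¹
      = (ρ x * A) * Matrix.single j k (1 : ℂ) * (A' * ρ x⁻¹) := by
      simp only [mul_assoc]
    rw [this, Matrix.mul_apply]
    rw [Finset.sum_eq_single k]
    · simp
    · intro b _ hb
      simp [Matrix.mul_single_apply_of_ne, hb]
    · simp
  simp only [h2] at h
  rw [h]
  by_cases h1 : i = l <;> by_cases h3 : j = k <;> simp [h1, h3]

lemma exists_intertwiner {H : Type*} [Group H] [Fintype H] {n : ℕ} (ρ σ : H →* Mt n)
    (hn : (n : ℂ) ≠ 0) (hs : ScalComm ρ)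
    (hχ : ∑ h : H, (σ h).trace * (ρ h⁻¹).trace ≠ 0) :
    ∃ T T' : Mt n, T * T' = 1 ∧ T' * T = 1 ∧ ∀ h, T * ρ h = σ h * T := by
  have key : ∃ j k, ∑ h : H, σ h * Matrix.single j k (1 : ℂ) * ρ h⁻¹ ≠ 0 := by
    by_contra! hcon
    apply hχ
    simp only [Matrix.trace, Finset.sum_mul_sum, Matrix.diag_apply]
    rw [Finset.sum_comm]
    refine Finset.sum_eq_zero fun i _ => ?_
    rw [Finset.sum_comm]
    refine Finset.sum_eq_zero fun k _ => ?_
    have h := congrFun (congrFun (hcon i k) i) k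
    rw [Matrix.sum_apply] at h
    rw [Matrix.zero_apply] at h
    rw [← h]
    refine Finset.sum_congr rfl fun x _ => ?_
    rw [Matrix.mul_apply, Finset.sum_eq_single k]
    · simp
    · intro b _ hb
      simp [hb, Matrix.mul_single_apply_of_ne]
    · simp
  obtain ⟨j, k, hT⟩ := key
  set T := ∑ h : H, σ h * Matrix.single j k (1 : ℂ) * ρ h⁻¹ with hTdef
  have hint : ∀ h, T * ρ h = σ h * T := by
    intro x
    rw [hTdef, Finset.sum_mul, Finset.mul_sum]
    refine Fintype.sum_equiv (Equiv.mulLeft x⁻¹) _ _ fun h => ?_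
    simp only [Equiv.coe_mulLeft, mul_inv_rev, inv_inv, map_mul]
    rw [← mul_assoc, ← mul_assoc, ← mul_assoc, ← mul_assoc, ← map_mul σ x x⁻¹]
    simp
  obtain ⟨a, b, hab⟩ : ∃ a b, T a b ≠ 0 := by
    by_contra! hcon
    exact hT (by ext a b; simpa using hcon a b)
  have hinv : (∑ h : H, ρ h * Matrix.single b a (1 : ℂ) * σ h⁻¹) * T =
      ((Nat.card H : ℂ) * T a b / n) • (1 : Mt n) := by
    have h1 := schur_avg ρ hn hs (Matrix.single b a (1 : ℂ) * T)
    rw [Matrix.trace_mul_comm] at h1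
    have h2 : (T * Matrix.single b a (1 : ℂ)).trace = T a b := by
      simp [Matrix.trace_mul_single]
    rw [h2] at h1
    rw [← h1, Finset.sum_mul]
    refine Finset.sum_congr rfl fun h _ => ?_
    rw [mul_assoc, ← hint, ← mul_assoc, ← mul_assoc]
  have hc : ((Nat.card H : ℂ) * T a b / n) ≠ 0 := by
    have : (Nat.card H : ℂ) ≠ 0 := by exact_mod_cast Nat.card_pos.ne'
    positivity
  set c := ((Nat.card H : ℂ) * T a b / n)
  have h3 : (c⁻¹ • (∑ h : H, ρ h * Matrix.single b a (1 : ℂ) * σ h⁻¹)) * T = 1 := by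
    rw [smul_mul_assoc, hinv, smul_smul, inv_mul_cancel₀ hc, one_smul]
  exact ⟨T, _, mul_eq_one_comm.mp h3, h3, hint⟩

lemma conj_trace {H : Type*} [Group H] [Fintype H] {n : ℕ} (ρ : H →* Mt n) (h : H) :
    (starRingEnd ℂ) (ρ h).trace = (ρ h⁻¹).trace := by
  open scoped ComplexOrder in
  set P : Mt n := ∑ k : H, (ρ k).conjTranspose * ρ k with hP
  have hpos : P.PosDef := by
    have h1 : P = 1 + ∑ k ∈ Finset.univ.erase (1 : H), (ρ k).conjTranspose * ρ k := by
      rw [hP, ← Finset.add_sum_erase _ _ (Finset.mem_univ (1 : H))]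
      simp
    rw [h1]
    refine Matrix.PosDef.one.add_posSemidef ?_
    exact Matrix.posSemidef_sum _ fun k _ => Matrix.posSemidef_conjTranspose_mul_self _
  have hu : IsUnit P := hpos.isUnit
  obtain ⟨Q, hQ⟩ := hu.exists_right_inv
  have h2 : (ρ h).conjTranspose * P = P * ρ h⁻¹ := by
    rw [hP, Finset.sum_mul, Finset.mul_sum]
    refine Fintype.sum_equiv (Equiv.mulRight h) _ _ fun k => ?_
    simp only [Equiv.coe_mulRight, map_mul, Matrix.conjTranspose_mul]
    rw [mul_assoc, mul_assoc, mul_assoc, ← map_mul ρ h h⁻¹]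
    simp
  have h3 : (ρ h).conjTranspose = P * ρ h⁻¹ * Q := by
    rw [← h2, mul_assoc, hQ, mul_one]
  have h4 := congrArg Matrix.trace h3
  rw [Matrix.trace_mul_comm, ← mul_assoc, mul_eq_one_comm.mp hQ, one_mul,
    Matrix.trace_conjTranspose] at h4
  exact h4

lemma trace_decomp {n : ℕ} (A : Mt n) (o : ℕ) (ho : o ≠ 0) (hA : A ^ o = 1) :
    (⨆ μ : ℂ, Module.End.eigenspace (Matrix.toLin' A) μ = ⊤) ∧
    ∃ s : Finset ℂ, (∀ μ ∈ s, μ ^ o = 1) ∧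
      A.trace = ∑ μ ∈ s, (Module.finrank ℂ (Module.End.eigenspace (Matrix.toLin' A) μ) : ℂ) * μ := by
  set f : Module.End ℂ (Fin n → ℂ) := Matrix.toLin' A with hf
  have hfo : f ^ o = 1 := by
    rw [hf, ← Matrix.toLin'_pow, hA, Matrix.toLin'_one]; rfl
  have hss : f.IsSemisimple := by
    refine Module.End.isSemisimple_of_squarefree_aeval_eq_zero
      (p := Polynomial.X ^ o - Polynomial.C 1) ?_ ?_
    · exact (Polynomial.separable_X_pow_sub_C (1 : ℂ) (by exact_mod_cast ho)
        one_ne_zero).squarefree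
    · simp [hfo]
  have htop := hss.iSup_eigenspace_eq_top
  refine ⟨htop, ?_⟩
  have hint := DirectSum.isInternal_submodule_of_iSupIndep_of_iSup_eq_top
    f.eigenspaces_iSupIndep htop
  have hfin : {μ : ℂ | f.eigenspace μ ≠ ⊥}.Finite :=
    WellFoundedGT.finite_ne_bot_of_iSupIndep f.eigenspaces_iSupIndep
  have hmaps : ∀ μ : ℂ, Set.MapsTo f (f.eigenspace μ) (f.eigenspace μ) := by
    intro μ v hv
    have hv' : f v = μ • v := Module.End.mem_eigenspace_iff.mp hv
    change f v ∈ f.eigenspace μ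
    rw [hv']
    exact Submodule.smul_mem _ _ hv
  have htr := LinearMap.trace_eq_sum_trace_restrict' hint hfin hmaps
  refine ⟨hfin.toFinset, ?_, ?_⟩
  · intro μ hμ
    rw [Set.Finite.mem_toFinset] at hμ
    obtain ⟨v, hv, hv0⟩ := (Submodule.ne_bot_iff _).mp hμ
    have hp : ∀ k : ℕ, (f ^ k) v = μ ^ k • v := by
      intro k
      induction k with
      | zero => simp
      | succ k ih =>
        rw [pow_succ', Module.End.mul_apply, ih, map_smul,
          Module.End.mem_eigenspace_iff.mp hv, smul_smul, pow_succ]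
    have h1 := hp o
    rw [hfo, Module.End.one_apply] at h1
    have h2 : (μ ^ o - 1) • v = 0 := by rw [sub_smul, one_smul, ← h1, sub_self]
    rcases smul_eq_zero.mp h2 with h3 | h3
    · exact sub_eq_zero.mp h3
    · exact absurd h3 hv0
  · rw [← Matrix.trace_toLin'_eq, htr]
    refine Finset.sum_congr rfl fun μ _ => ?_
    have : f.restrict (hmaps μ) = μ • LinearMap.id := by
      refine LinearMap.ext fun v => Subtype.ext ?_
      exact Module.End.mem_eigenspace_iff.mp v.2
    rw [this, map_smul, LinearMap.trace_id, smul_eq_mul, mul_comm]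

lemma trace_integral {n : ℕ} (A : Mt n) (o : ℕ) (ho : o ≠ 0) (hA : A ^ o = 1) :
    IsIntegral ℤ A.trace := by
  obtain ⟨-, s, hs, h⟩ := trace_decomp A o ho hA
  rw [h]
  refine IsIntegral.sum _ fun μ hμ => IsIntegral.mul ?_ ?_
  · exact_mod_cast (isIntegral_algebraMap (R := ℤ) (A := ℂ)
      (x := (Module.finrank ℂ (Module.End.eigenspace (Matrix.toLin' A) μ) : ℤ)))
  · refine IsIntegral.of_pow (Nat.pos_of_ne_zero ho) ?_
    rw [hs μ hμ]
    exact isIntegral_one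

lemma even_finrank_of_alt {V : Type*} [AddCommGroup V] [Module ℂ V] [FiniteDimensional ℂ V]
    (β : V →ₗ[ℂ] V →ₗ[ℂ] ℂ) (hskew : ∀ u v, β u v = - β v u)
    (hnd : ∀ u, (∀ v, β u v = 0) → u = 0) : Even (Module.finrank ℂ V) := by
  let b := Module.finBasis ℂ V
  set M := LinearMap.toMatrix₂ b b β with hM
  have hMt : M.transpose = -M := by
    ext i j
    simp [hM, LinearMap.toMatrix₂_apply, hskew (b j) (b i)]
  have hdet : M.det ≠ 0 := by
    intro h0
    obtain ⟨v, hv, hv0⟩ := Matrix.exists_vecMul_eq_zero_iff.mpr h0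
    have hz : ∑ i, v i • b i = 0 := by
      apply hnd
      intro w
      rw [← b.sum_repr w]
      simp only [map_sum, map_smul, LinearMap.sum_apply, LinearMap.smul_apply]
      refine Finset.sum_eq_zero fun j _ => ?_
      have := congrFun hv0 j
      simp only [Matrix.vecMul, dotProduct, hM, LinearMap.toMatrix₂_apply, Pi.zero_apply] at this
      simp only [smul_eq_mul]
      rw [this, mul_zero]
    have := Fintype.linearIndependent_iff.mp b.linearIndependent v hz
    exact hv (funext this)
  by_contra hodd
  rw [Nat.not_even_iff_odd] at hodd
  have h1 := congrArg Matrix.det hMt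
  rw [Matrix.det_transpose, Matrix.det_neg, Fintype.card_fin, hodd.neg_one_pow] at h1
  apply hdet
  linear_combination h1 / 2

lemma trace_even_of_skew {n : ℕ} (A S S' : Mt n) (o : ℕ) (ho : o ≠ 0) (hA : A ^ o = 1)
    (hS : S.transpose = -S) (hS' : S * S' = 1) (hSA : (S * A).transpose = -(S * A)) :
    ∃ r : ℂ, IsIntegral ℤ r ∧ A.trace = 2 * r := by
  obtain ⟨htop, s, hs, h⟩ := trace_decomp A o ho hA
  set f : Module.End ℂ (Fin n → ℂ) := Matrix.toLin' A with hf
  let β : (Fin n → ℂ) →ₗ[ℂ] (Fin n → ℂ) →ₗ[ℂ] ℂ := Matrix.toLinearMap₂' ℂ S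
  have hβ : ∀ u v, β u v = u ⬝ᵥ (S.mulVec v) := fun u v =>
    Matrix.toLinearMap₂'_apply' S u v
  have hskew : ∀ u v, β u v = - β v u := by
    intro u v
    rw [hβ, hβ, Matrix.dotProduct_mulVec, ← Matrix.mulVec_transpose, hS, Matrix.neg_mulVec,
      neg_dotProduct, dotProduct_comm]
  have hAT : A.transpose * S = S * A := by
    rw [Matrix.transpose_mul, hS, mul_neg] at hSA
    exact neg_injective hSA
  have hadj : ∀ u v, β (f u) v = β u (f v) := by
    intro u v
    rw [hβ, hβ, hf, Matrix.toLin'_apply, Matrix.toLin'_apply, Matrix.mulVec_mulVec, ← hAT,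
      ← Matrix.mulVec_mulVec, Matrix.dotProduct_mulVec u, Matrix.vecMul_transpose]
  have hnd : ∀ u, (∀ v, β v u = 0) → u = 0 := by
    intro u hu
    have h1 : S.mulVec u = 0 := by
      refine dotProduct_eq_zero _ fun w => ?_
      rw [dotProduct_comm, ← hβ]
      exact hu w
    have h2 := congrArg (S'.mulVec) h1
    rwa [Matrix.mulVec_mulVec, mul_eq_one_comm.mp hS', Matrix.one_mulVec, Matrix.mulVec_zero] at h2
  have heven : ∀ μ : ℂ, Even (Module.finrank ℂ (f.eigenspace μ)) := by
    intro μ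
    refine even_finrank_of_alt (β.domRestrict₁₂ (f.eigenspace μ) (f.eigenspace μ))
      (fun u v => hskew _ _) ?_
    intro u hu
    apply Subtype.ext
    apply hnd
    intro v
    have hv : v ∈ ⨆ μ : ℂ, f.eigenspace μ := by rw [htop]; trivial
    induction hv using Submodule.iSup_induction' with
    | mem ν v hv =>
      by_cases hν : ν = μ
      · subst hν
        rw [hskew, neg_eq_zero]
        exact hu ⟨v, hv⟩
      · have h1 := hadj v u
        rw [Module.End.mem_eigenspace_iff.mp hv, Module.End.mem_eigenspace_iff.mp u.2, map_smul,
          map_smul, LinearMap.smul_apply] at h1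
        have h2 : (ν - μ) * β v u = 0 := by
          simp only [smul_eq_mul] at h1
          linear_combination h1
        exact (mul_eq_zero.mp h2).resolve_left (sub_ne_zero.mpr hν)
    | zero => simp
    | add x y _ _ hx hy => rw [map_add, LinearMap.add_apply, hx, hy, add_zero]
  choose m hm using heven
  refine ⟨∑ μ ∈ s, (m μ : ℂ) * μ, ?_, ?_⟩
  · refine IsIntegral.sum _ fun μ hμ => IsIntegral.mul ?_ ?_
    · exact_mod_cast (isIntegral_algebraMap (R := ℤ) (A := ℂ) (x := (m μ : ℤ)))
    · refine IsIntegral.of_pow (Nat.pos_of_ne_zero ho) ?_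
      rw [hs μ hμ]
      exact isIntegral_one
  · rw [h, Finset.mul_sum]
    refine Finset.sum_congr rfl fun μ _ => ?_
    rw [hm μ]
    push_cast
    ring

lemma rep_trace_integral {H : Type*} [Group H] [Fintype H] {n : ℕ} (ρ : H →* Mt n) (g : H) :
    IsIntegral ℤ (ρ g).trace :=
  trace_integral (ρ g) (Nat.card H) Nat.card_pos.ne' (by
    rw [← map_pow, pow_card_eq_one', map_one])

lemma rep_trace_conj {H : Type*} [Group H] {n : ℕ} (ρ : H →* Mt n) {g k : H} (h : IsConj g k) :
    (ρ g).trace = (ρ k).trace := by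
  obtain ⟨x, rfl⟩ := isConj_iff.mp h
  rw [map_mul, Matrix.trace_mul_comm, ← map_mul]
  simp [← mul_assoc]

/-- central character values are algebraic integers -/
lemma omega_integral {H : Type*} [Group H] [Fintype H] {n : ℕ} (ρ : H →* Mt n) (hn : (n : ℂ) ≠ 0)
    (hs : ScalComm ρ) (g : H) :
    ∃ w : ℂ, IsIntegral ℤ w ∧
      w * n = ((Finset.univ.filter fun x => IsConj g x).card : ℂ) * (ρ g).trace := by
  set K := Finset.univ.filter fun x => IsConj g x with hK
  have hne : Nonempty (Fin n) := by
    rcases Nat.eq_zero_or_pos n with h | h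
    · exact absurd (by rw [h]; simp) hn
    · exact ⟨⟨0, h⟩⟩
  obtain ⟨c, hc⟩ := hs (∑ x ∈ K, ρ x) (by
    intro h
    rw [Finset.sum_mul, Finset.mul_sum]
    refine Finset.sum_bij' (fun x _ => h⁻¹ * x * h) (fun x _ => h * x * h⁻¹) ?_ ?_ ?_ ?_ ?_
    · intro x hx
      simp only [hK, Finset.mem_filter, Finset.mem_univ, true_and] at hx ⊢
      exact hx.trans (isConj_iff.mpr ⟨h⁻¹, by group⟩)
    · intro x hx
      simp only [hK, Finset.mem_filter, Finset.mem_univ, true_and] at hx ⊢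
      exact hx.trans (isConj_iff.mpr ⟨h, by group⟩)
    · intro x hx; group
    · intro x hx; group
    · intro x hx
      rw [← map_mul, ← map_mul]
      congr 1
      group)
  refine ⟨c, ?_, ?_⟩
  · let φ : MonoidAlgebra ℤ H →ₐ[ℤ] Mt n := MonoidAlgebra.lift ℤ (Mt n) H ρ
    have h1 : IsIntegral ℤ (∑ x ∈ K, MonoidAlgebra.of ℤ H x) := IsIntegral.of_finite ℤ _
    have h2 := h1.map φ
    rw [map_sum] at h2
    have h3 : ∀ x, φ (MonoidAlgebra.of ℤ H x) = ρ x := fun x => by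
      simp [φ]
    simp only [h3] at h2
    rw [hc, ← Algebra.algebraMap_eq_smul_one] at h2
    exact (isIntegral_algebraMap_iff (algebraMap ℂ (Mt n)).injective).mp h2
  · have h1 := congrArg Matrix.trace hc
    rw [Matrix.trace_sum, Matrix.trace_smul, Matrix.trace_one, Fintype.card_fin, smul_eq_mul] at h1
    rw [← h1, ← nsmul_eq_mul, ← Finset.sum_const]
    refine Finset.sum_congr rfl fun x hx => ?_
    simp only [hK, Finset.mem_filter, Finset.mem_univ, true_and] at hx
    exact (rep_trace_conj ρ hx).symm

lemma class_even {H : Type*} [Group H] [Fintype H] {n : ℕ} (ρ : H →* Mt n) (hn : (n : ℂ) ≠ 0)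
    (hs : ScalComm ρ) (S : Finset H) (hconj : ∀ g ∈ S, ∀ k, IsConj g k → k ∈ S)
    (hinv : ∀ g ∈ S, g⁻¹ ∈ S)
    (h : ∀ g ∈ S, IsConj g g⁻¹ → ∃ r : ℂ, IsIntegral ℤ r ∧ (ρ g).trace = 2 * r) :
    ∃ r : ℂ, IsIntegral ℤ r ∧ ∑ g ∈ S, (ρ g).trace * (ρ g⁻¹).trace = n * (2 * r) := by
  let A := integralClosure ℤ ℂ
  choose w hw hwn using fun g => omega_integral ρ hn hs g
  -- values as elements of A
  let F : ConjClasses H → A := fun K =>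
    ⟨w K.out, hw _⟩ * ⟨(ρ (K.out)⁻¹).trace, rep_trace_integral ρ _⟩
  have hout : ∀ g : H, IsConj g (Quotient.out (ConjClasses.mk g)) := fun g =>
    (ConjClasses.mk_eq_mk_iff_isConj.mp (Quotient.out_eq (ConjClasses.mk g))).symm
  have hmk : ∀ K : ConjClasses H, ConjClasses.mk K.out = K := fun K => Quotient.out_eq K
  have hci : ∀ {a b : H}, IsConj a b → IsConj a⁻¹ b⁻¹ := by
    intro a b hab
    obtain ⟨x, rfl⟩ := isConj_iff.mp hab
    exact isConj_iff.mpr ⟨x, by group⟩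
  have hcard : ∀ {a b : H}, IsConj a b → (Finset.univ.filter fun x => IsConj a x)
      = (Finset.univ.filter fun x => IsConj b x) := by
    intro a b hab
    ext x
    simp only [Finset.mem_filter, Finset.mem_univ, true_and]
    exact ⟨fun h => hab.symm.trans h, fun h => hab.trans h⟩
  have hwc : ∀ {a b : H}, IsConj a b → w a = w b := by
    intro a b hab
    apply mul_right_cancel₀ hn
    rw [hwn, hwn, hcard hab, rep_trace_conj ρ hab]
  have hcardinv : ∀ a : H, (Finset.univ.filter fun x => IsConj a x).card
      = (Finset.univ.filter fun x => IsConj a⁻¹ x).card := by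
    intro a
    refine Finset.card_bij' (fun x _ => x⁻¹) (fun x _ => x⁻¹) ?_ ?_ ?_ ?_
    · intro x hx
      simp only [Finset.mem_filter, Finset.mem_univ, true_and] at hx ⊢
      exact hci hx
    · intro x hx
      simp only [Finset.mem_filter, Finset.mem_univ, true_and] at hx ⊢
      simpa using hci hx
    · simp
    · simp
  let T : Finset (ConjClasses H) := S.image ConjClasses.mk
  have hT : ∀ K, K ∈ T ↔ K.out ∈ S := by
    intro K
    constructor
    · intro hK
      obtain ⟨g, hg, rfl⟩ := Finset.mem_image.mp hK
      exact hconj g hg _ (hout g)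
    · intro hK
      exact Finset.mem_image.mpr ⟨_, hK, hmk K⟩
  -- the sum
  have hsum : ∑ g ∈ S, (ρ g).trace * (ρ g⁻¹).trace = n * ((∑ K ∈ T, F K : A) : ℂ) := by
    rw [← Finset.sum_fiberwise_of_maps_to (s := S) (t := T) (g := ConjClasses.mk)
      (fun g hg => Finset.mem_image_of_mem _ hg)]
    rw [AddSubmonoidClass.coe_finsetSum, Finset.mul_sum]
    refine Finset.sum_congr rfl fun K hK => ?_
    have h1 : ∀ g ∈ S.filter (fun g => ConjClasses.mk g = K),
        (ρ g).trace * (ρ g⁻¹).trace = (ρ K.out).trace * (ρ (K.out)⁻¹).trace := by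
      intro g hg
      obtain ⟨-, rfl⟩ := Finset.mem_filter.mp hg
      rw [rep_trace_conj ρ (hout g), rep_trace_conj ρ (hci (hout g))]
    rw [Finset.sum_congr rfl h1, Finset.sum_const, nsmul_eq_mul]
    have h2 : S.filter (fun g => ConjClasses.mk g = K)
        = Finset.univ.filter fun x => IsConj K.out x := by
      ext x
      simp only [Finset.mem_filter, Finset.mem_univ, true_and]
      constructor
      · rintro ⟨-, rfl⟩
        exact (hout x).symm
      · intro hx
        refine ⟨hconj _ ((hT K).mp hK) _ hx, ?_⟩
        rw [← hmk K]
        exact ConjClasses.mk_eq_mk_iff_isConj.mpr hx.symm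
    rw [h2, ← mul_assoc, ← hwn]
    change _ = (n : ℂ) * (w K.out * (ρ (K.out)⁻¹).trace)
    ring
  let I : Ideal A := Ideal.span {2}
  have hzero : ∑ K ∈ T, Ideal.Quotient.mk I (F K) = 0 := by
    have h2 : (Ideal.Quotient.mk I) 2 = 0 :=
      Ideal.Quotient.eq_zero_iff_mem.mpr (Ideal.mem_span_singleton_self 2)
    have houti : ∀ K : ConjClasses H,
        IsConj (K.out)⁻¹ (Quotient.out (ConjClasses.mk (K.out)⁻¹)) := fun K => hout _
    have hFinv : ∀ K, F (ConjClasses.mk (K.out)⁻¹) = F K := by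
      intro K
      apply Subtype.ext
      change w _ * (ρ _).trace = w _ * (ρ _).trace
      rw [← hwc (houti K), ← rep_trace_conj ρ (hci (houti K)), inv_inv]
      apply mul_right_cancel₀ hn
      have e1 := hwn (K.out)⁻¹
      have e2 := hwn (K.out)
      rw [← hcardinv] at e1
      linear_combination (ρ K.out).trace * e1 - (ρ (K.out)⁻¹).trace * e2
    refine Finset.sum_involution (fun K _ => ConjClasses.mk (K.out)⁻¹) ?_ ?_ ?_ ?_
    · intro K hK
      simp only [hFinv]
      rw [← map_add, ← two_mul, map_mul, h2, zero_mul]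
    · intro K hK hne heq
      apply hne
      have hreal : IsConj (K.out)⁻¹ ((K.out)⁻¹)⁻¹ := by
        have := houti K
        change ConjClasses.mk (Quotient.out K)⁻¹ = K at heq
        rw [heq] at this
        simpa using this
      obtain ⟨r, hr, hr2⟩ := h _ (hinv _ ((hT K).mp hK)) hreal
      rw [Ideal.Quotient.eq_zero_iff_mem, Ideal.mem_span_singleton]
      refine ⟨⟨w K.out, hw _⟩ * ⟨r, hr⟩, ?_⟩
      apply Subtype.ext
      change w _ * (ρ _).trace = 2 * (w _ * r)
      rw [hr2]; ring
    · intro K hK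
      rw [hT]
      exact hconj _ (hinv _ ((hT K).mp hK)) _ (houti K)
    · intro K hK
      refine Eq.trans ?_ (hmk K)
      apply ConjClasses.mk_eq_mk_iff_isConj.mpr
      have h9 := (hci (houti K)).symm
      rw [inv_inv] at h9
      exact h9
  rw [← map_sum, Ideal.Quotient.eq_zero_iff_mem, Ideal.mem_span_singleton] at hzero
  obtain ⟨r, hr⟩ := hzero
  refine ⟨r, r.2, ?_⟩
  rw [hsum, hr]
  rfl

lemma odd_not_two_mul (d : ℕ) (hd : Odd d) (r : ℂ) (hr : IsIntegral ℤ r) (h : (d : ℂ) = 2 * r) :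
    False := by
  have h1 : r = algebraMap ℚ ℂ ((d : ℚ) / 2) := by
    simp only [map_div₀, map_natCast, map_ofNat]
    rw [h]; ring
  rw [h1] at hr
  have h2 := (isIntegral_algebraMap_iff (algebraMap ℚ ℂ).injective).mp hr
  obtain ⟨z, hz⟩ := IsIntegrallyClosed.isIntegral_iff.mp h2
  have h3 : (2 * z : ℚ) = d := by
    simp only [algebraMap_int_eq, eq_intCast] at hz
    rw [hz]; ring
  have h4 : 2 * z = (d : ℤ) := by exact_mod_cast h3
  obtain ⟨k, rfl⟩ := hd
  omega

lemma card_class_mul {H : Type*} [Group H] [Fintype H] (g : H) :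
    (Finset.univ.filter fun x => IsConj g x).card * (Finset.univ.filter fun x => x * g = g * x).card
      = Nat.card H := by
  rw [Nat.card_eq_fintype_card, ← Finset.card_univ]
  rw [Finset.card_eq_sum_card_fiberwise (s := Finset.univ)
    (t := Finset.univ.filter fun x => IsConj g x) (f := fun x : H => x * g * x⁻¹)]
  · rw [Finset.sum_const_nat]
    intro k hk
    simp only [Finset.mem_filter, Finset.mem_univ, true_and] at hk
    obtain ⟨y, rfl⟩ := isConj_iff.mp hk
    refine Finset.card_bij' (fun x _ => y⁻¹ * x) (fun x _ => y * x) ?_ ?_ ?_ ?_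
    · intro x hx
      simp only [Finset.mem_filter, Finset.mem_univ, true_and] at hx ⊢
      have : x * g = y * g * y⁻¹ * x := by rw [← hx]; group
      rw [mul_assoc, this]; group
    · intro x hx
      simp only [Finset.mem_filter, Finset.mem_univ, true_and] at hx ⊢
      have : y * x * g * (y * x)⁻¹ = y * (x * g) * x⁻¹ * y⁻¹ := by group
      rw [this, hx]; group
    · intro x _; group
    · intro x _; group
  · intro x _
    simp only [Finset.coe_filter, Finset.mem_univ, true_and, Set.mem_ofPred_eq]
    exact isConj_iff.mpr ⟨x, rfl⟩

/-- if the centralizer is odd and `g` is real, an element with `x⁻¹ = x` inverts `g`. -/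
lemma exists_inverting {H : Type*} [Group H] [Fintype H] (g : H) (hg : IsConj g g⁻¹)
    (hodd : Odd (Finset.univ.filter fun x => x * g = g * x).card) :
    ∃ x : H, x⁻¹ = x ∧ x * g = g⁻¹ * x := by
  by_contra! hcon
  obtain ⟨y, hy⟩ := isConj_iff.mp hg
  set Y := Finset.univ.filter fun x => x * g = g⁻¹ * x with hY
  have hcard : Y.card = (Finset.univ.filter fun x => x * g = g * x).card := by
    refine Finset.card_bij' (fun x _ => y⁻¹ * x) (fun x _ => y * x) ?_ ?_ ?_ ?_
    · intro x hx
      simp only [hY, Finset.mem_filter, Finset.mem_univ, true_and] at hx ⊢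
      rw [mul_assoc, hx, ← hy]; group
    · intro x hx
      simp only [hY, Finset.mem_filter, Finset.mem_univ, true_and] at hx ⊢
      rw [mul_assoc, hx, ← hy]; group
    · intro x _; group
    · intro x _; group
  have h0 : ∑ x ∈ Y, (1 : ZMod 2) = 0 := by
    refine Finset.sum_involution (fun x _ => x⁻¹) ?_ ?_ ?_ ?_
    · intro x _; decide
    · intro x hx _ hxx
      simp only [hY, Finset.mem_filter, Finset.mem_univ, true_and] at hx
      exact hcon x hxx hx
    · intro x hx
      simp only [hY, Finset.mem_filter, Finset.mem_univ, true_and] at hx ⊢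
      have h1 : g = x⁻¹ * g⁻¹ * x := by rw [mul_assoc, ← hx]; group
      have h2 : g⁻¹ = x⁻¹ * g * x := by
        have := congrArg (·⁻¹) h1
        simp only [mul_inv_rev, inv_inv] at this
        rw [this]; group
      rw [h2]; group
    · intro x _; simp
  rw [Finset.sum_const, nsmul_eq_mul, mul_one, ZMod.natCast_eq_zero_iff_even, hcard] at h0
  exact (Nat.not_even_iff_odd.mpr hodd) h0

lemma not_skew {H : Type*} [Group H] [Fintype H] {n : ℕ} (ρ : H →* Mt n) (hn : (n : ℂ) ≠ 0)
    (hs : ScalComm ρ) (hχ : ∑ h : H, (ρ h).trace * (ρ h⁻¹).trace = (Nat.card H : ℂ))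
    (d : ℕ) (hd : Odd d) (hnd : (n : ℂ) * d = Nat.card H)
    (B B' : Mt n) (hB : B * B' = 1) (hinv : ∀ h, (ρ h).transpose * B = B * ρ h⁻¹) :
    B.transpose ≠ -B := by
  intro hskew
  obtain ⟨r, hr, hsum⟩ := class_even ρ hn hs Finset.univ (by simp) (by simp) (by
    intro g _ hg
    rcases Nat.even_or_odd (Finset.univ.filter fun x => x * g = g * x).card with he | ho
    · obtain ⟨c, hc⟩ := he
      obtain ⟨w, hw, hwn⟩ := omega_integral ρ hn hs g
      obtain ⟨k, hk⟩ := hd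
      have hcl : ((Finset.univ.filter fun x => IsConj g x).card : ℂ) * (c + c) = n * d := by
        rw [hnd, ← card_class_mul g, hc]; push_cast; ring
      have e1 : w * (c + c) = d * (ρ g).trace := by
        apply mul_right_cancel₀ hn
        linear_combination (c + c : ℂ) * hwn + (ρ g).trace * hcl
      refine ⟨w * c - k * (ρ g).trace, ?_, ?_⟩
      · have hnat : ∀ m : ℕ, IsIntegral ℤ (m : ℂ) := fun m => by
          exact_mod_cast (isIntegral_algebraMap (R := ℤ) (A := ℂ) (x := (m : ℤ)))
        exact (hw.mul (hnat c)).sub ((hnat k).mul (rep_trace_integral ρ g))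
      · rw [hk] at e1
        push_cast at e1
        linear_combination -e1
    · obtain ⟨x, hx, hxg⟩ := exists_inverting g hg ho
      refine trace_even_of_skew (ρ g) (B * ρ x) (ρ x⁻¹ * B') (Nat.card H) Nat.card_pos.ne' ?_ ?_ ?_ ?_
      · rw [← map_pow, pow_card_eq_one', map_one]
      · rw [Matrix.transpose_mul, hskew, mul_neg, hinv, hx]
      · have : B * ρ x * (ρ x⁻¹ * B') = B * (ρ x * ρ x⁻¹) * B' := by simp only [mul_assoc]
        rw [this, ← map_mul]; simp [hB]
      · rw [mul_assoc, ← map_mul, Matrix.transpose_mul, hskew, mul_neg, hinv, mul_inv_rev, hx, hxg])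
  rw [hχ, ← hnd] at hsum
  exact odd_not_two_mul d hd r hr (mul_left_cancel₀ hn hsum)

lemma inner_main {M : Type*} [Group M] [Fintype M] {n : ℕ} (R : M →* Mt n) (N : Subgroup M)
    [N.Normal] (t : M) (ht : t ∉ N) (ht2 : t ^ 2 ∈ N) (hM : ∀ m, m ∈ N ∨ m * t⁻¹ ∈ N)
    (hnorm : ∑ x : N, (R x).trace * (R (x : M)⁻¹).trace = (Nat.card N : ℂ))
    (hreal : ∀ x ∈ N, (R x⁻¹).trace = (R x).trace)
    (d : ℕ) (hd : Odd d) (hnd : (n : ℂ) * d = Nat.card N) :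
    (∀ m, (R m⁻¹).trace = (R m).trace) ∧
      ∑ x : N, (R ((x * t) ^ 2)).trace = (Nat.card N : ℂ) := by
  have hcN : (Nat.card N : ℂ) ≠ 0 := by exact_mod_cast Nat.card_pos.ne'
  have hn : (n : ℂ) ≠ 0 := by
    intro h0
    rw [h0, zero_mul] at hnd
    exact hcN hnd.symm
  let ρ : N →* Mt n := R.comp N.subtype
  have hρ : ∀ x : N, ρ x = R x := fun x => rfl
  have hχ : ∑ h : N, (ρ h).trace * (ρ h⁻¹).trace = (Nat.card N : ℂ) := hnorm
  have hs : ScalComm ρ := scalComm_of_norm ρ hχ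
  have hsR : ScalComm R := fun X hX => hs X fun h => hX h
  let σ : N →* Mt n :=
    { toFun := fun x => (ρ x⁻¹).transpose
      map_one' := by simp
      map_mul' := fun x y => by
        rw [mul_inv_rev, map_mul, Matrix.transpose_mul] }
  have hσ : ∀ x : N, σ x = (ρ x⁻¹).transpose := fun x => rfl
  obtain ⟨B, B', hBB', hB'B, hB⟩ := exists_intertwiner ρ σ hn hs (by
    have : ∑ h : N, (σ h).trace * (ρ h⁻¹).trace = Nat.card N := by
      rw [← hχ]
      refine Finset.sum_congr rfl fun x _ => ?_
      rw [hσ, Matrix.trace_transpose]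
      congr 1
      exact hreal x x.2
    rw [this]
    exact hcN)
  have hRcancel : ∀ m, R m * R m⁻¹ = 1 := fun m => by rw [← map_mul]; simp
  have hinv : ∀ x : N, (ρ x).transpose * B = B * ρ x⁻¹ := by
    intro x
    rw [hB, hσ, inv_inv]
  have hinv' : ∀ x ∈ N, (R x).transpose * B * R x = B := by
    intro x hx
    have := hinv ⟨x, hx⟩
    change (R x).transpose * B = B * R x⁻¹ at this
    rw [this, mul_assoc, ← map_mul]; simp
  have huniq : ∀ X : Mt n, (∀ x ∈ N, (R x).transpose * X * R x = X) → ∃ c : ℂ, X = c • B := by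
    intro X hX
    obtain ⟨c, hc⟩ := hs (B' * X) (by
      intro x
      have h1 : X * ρ x = (ρ x⁻¹).transpose * X := by
        have := hX _ (x⁻¹).2
        change (ρ x⁻¹).transpose * X * ρ x⁻¹ = X at this
        conv_lhs => rw [← this]
        rw [mul_assoc, ← map_mul]; simp
      have h2 : B' * (ρ x⁻¹).transpose = ρ x * B' := by
        have h3 := hinv x⁻¹
        rw [inv_inv] at h3
        calc B' * (ρ x⁻¹).transpose = B' * ((ρ x⁻¹).transpose * B) * B' := by
              simp only [mul_assoc, hBB', mul_one]
          _ = ρ x * B' := by rw [h3, ← mul_assoc, hB'B, one_mul]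
      rw [mul_assoc, h1, ← mul_assoc, h2, mul_assoc])
    refine ⟨c, ?_⟩
    calc X = B * (B' * X) := by rw [← mul_assoc, hBB', one_mul]
      _ = c • B := by rw [hc, mul_smul_comm, mul_one]
  have hB0 : B ≠ 0 := by
    intro h0
    rw [h0, zero_mul] at hBB'
    have := congrArg Matrix.trace hBB'
    rw [Matrix.trace_zero, Matrix.trace_one, Fintype.card_fin] at this
    exact hn this.symm
  have hpm : ∀ c : ℂ, c ^ 2 • B = B → c = 1 ∨ c = -1 := by
    intro c hc
    have : (c ^ 2 - 1) • B = 0 := by rw [sub_smul, hc, one_smul, sub_self]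
    have h2 := (smul_eq_zero.mp this).resolve_right hB0
    have h3 : (c - 1) * (c + 1) = 0 := by linear_combination h2
    rcases mul_eq_zero.mp h3 with h4 | h4
    · exact Or.inl (sub_eq_zero.mp h4)
    · exact Or.inr (eq_neg_of_add_eq_zero_left h4)
  have hsym : B.transpose = B := by
    obtain ⟨e, he⟩ := huniq B.transpose (by
      intro x hx
      have := congrArg Matrix.transpose (hinv' x hx)
      rw [Matrix.transpose_mul, Matrix.transpose_mul, Matrix.transpose_transpose] at this
      rw [mul_assoc]
      exact this)
    rcases hpm e (by
      have := congrArg Matrix.transpose he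
      rw [Matrix.transpose_transpose, Matrix.transpose_smul, he, smul_smul] at this
      rw [pow_two]
      exact this.symm) with rfl | rfl
    · rw [he, one_smul]
    · exact absurd (by rw [he, neg_smul, one_smul])
        (not_skew ρ hn hs hχ d hd hnd B B' hBB' hinv)
  obtain ⟨c, hc⟩ := huniq ((R t).transpose * B * R t) (by
    intro x hx
    have h1 := hinv' (t * x * t⁻¹) (Subgroup.Normal.conj_mem inferInstance x hx t)
    have h2 : R t * R x = R (t * x * t⁻¹) * R t := by
      rw [← map_mul, ← map_mul]; congr 1; group
    calc (R x).transpose * ((R t).transpose * B * R t) * R x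
        = (R t * R x).transpose * B * (R t * R x) := by
          rw [Matrix.transpose_mul]; simp only [mul_assoc]
      _ = (R t).transpose * ((R (t * x * t⁻¹)).transpose * B * R (t * x * t⁻¹)) * R t := by
          rw [h2, Matrix.transpose_mul]; simp only [mul_assoc]
      _ = (R t).transpose * B * R t := by rw [h1])
  have hc2 : c = 1 ∨ c = -1 := by
    apply hpm
    have h1 := hinv' (t ^ 2) ht2
    have h2 : (R (t ^ 2)).transpose * B * R (t ^ 2)
        = (R t).transpose * ((R t).transpose * B * R t) * R t := by
      rw [pow_two, map_mul, Matrix.transpose_mul]; simp only [mul_assoc]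
    rw [h2, hc, mul_smul_comm, smul_mul_assoc, hc, smul_smul] at h1
    rw [pow_two]
    exact h1
  have hout : ∀ m, m ∉ N → (R m).transpose * B * R m = c • B := by
    intro m hm
    have h1 := (hM m).resolve_left hm
    have h2 : R m = R (m * t⁻¹) * R t := by rw [← map_mul]; congr 1; group
    calc (R m).transpose * B * R m
        = (R t).transpose * ((R (m * t⁻¹)).transpose * B * R (m * t⁻¹)) * R t := by
          rw [h2, Matrix.transpose_mul]; simp only [mul_assoc]
      _ = c • B := by rw [hinv' _ h1, hc]
  have hxt : ∀ x : N, (x : M) * t ∉ N := by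
    intro x hx
    exact ht ((Subgroup.mul_mem_cancel_left N x.2).mp hx)
  have hsumout : ∀ F : M → ℂ, ∑ g ∈ Finset.univ.filter (fun g => g ∉ N), F g
      = ∑ x : N, F (x * t) := by
    intro F
    symm
    refine Finset.sum_bij (fun x _ => (x : M) * t) ?_ ?_ ?_ ?_
    · intro x _
      simpa using hxt x
    · intro x _ y _ hxy
      exact Subtype.ext (mul_right_cancel hxy)
    · intro g hg
      simp only [Finset.mem_filter, Finset.mem_univ, true_and] at hg
      exact ⟨⟨g * t⁻¹, (hM g).resolve_left hg⟩, Finset.mem_univ _, by simp⟩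
    · intro x _; rfl
  have htrout : ∀ m, m ∉ N → (R m).trace = c * (R m⁻¹).trace := by
    intro m hm
    have h1 : (R m).transpose = c • (B * R m⁻¹ * B') := by
      calc (R m).transpose = (R m).transpose * B * R m * R m⁻¹ * B' := by
            rw [mul_assoc _ (R m), hRcancel, mul_one, mul_assoc, hBB', mul_one]
        _ = _ := by rw [hout m hm, smul_mul_assoc, smul_mul_assoc]
    have h2 := congrArg Matrix.trace h1
    rw [Matrix.trace_transpose, Matrix.trace_smul, Matrix.trace_mul_comm, ← mul_assoc, hB'B,
      one_mul, smul_eq_mul] at h2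
    exact h2
  have hent : ∀ i j k l : Fin n, ∑ x : N, (R (x * t)) i j * (R (x * t)⁻¹) k l =
      if i = l ∧ j = k then (Nat.card N : ℂ) / n else 0 := by
    intro i j k l
    rw [← schur_entries ρ hn hs (R t) (R t⁻¹) (hRcancel t) i j k l]
    refine Finset.sum_congr rfl fun x _ => ?_
    rw [map_mul, mul_inv_rev, map_mul]
    rfl
  have hc1 : c = 1 := by
    rcases hc2 with h | h
    · exact h
    · exfalso
      obtain ⟨r, hr, hsum⟩ := class_even R hn hsR (Finset.univ.filter (fun g => g ∉ N)) (by
        intro g hg k hk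
        simp only [Finset.mem_filter, Finset.mem_univ, true_and] at hg ⊢
        obtain ⟨x, rfl⟩ := isConj_iff.mp hk
        intro hmem
        apply hg
        have := Subgroup.Normal.conj_mem (H := N) inferInstance _ hmem x⁻¹
        have h2 : x⁻¹ * (x * g * x⁻¹) * x⁻¹⁻¹ = g := by group
        rwa [h2] at this) (by simp) (by
        intro g hg hgg
        simp only [Finset.mem_filter, Finset.mem_univ, true_and] at hg
        refine ⟨0, isIntegral_zero, ?_⟩
        have h1 := htrout g hg
        rw [← rep_trace_conj R hgg, h] at h1
        linear_combination h1 / 2)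
      rw [hsumout] at hsum
      have h2 : ∑ x : N, (R (x * t)).trace * (R (x * t)⁻¹).trace = Nat.card N := by
        simp only [Matrix.trace, Finset.sum_mul_sum, Matrix.diag_apply]
        rw [Finset.sum_comm]
        have : ∀ i : Fin n, ∑ x : N, ∑ j : Fin n, (R (x * t)) i i * (R (x * t)⁻¹) j j
            = (Nat.card N : ℂ) / n := by
          intro i
          rw [Finset.sum_comm]
          simp only [hent]
          simp
        simp only [this]
        simp
        field_simp
      rw [h2, ← hnd] at hsum
      exact odd_not_two_mul d hd r hr (mul_left_cancel₀ hn hsum)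
  subst hc1
  refine ⟨?_, ?_⟩
  · intro m
    by_cases hm : m ∈ N
    · exact hreal m hm
    · rw [htrout m hm, one_mul]
  · have hsym' : B'.transpose = B' := by
      have h1 := congrArg Matrix.transpose hBB'
      rw [Matrix.transpose_mul, hsym, Matrix.transpose_one] at h1
      calc B'.transpose = B'.transpose * (B * B') := by rw [hBB', mul_one]
        _ = B' := by rw [← mul_assoc, h1, one_mul]
    have hterm : ∀ x : N, (R ((x * t) ^ 2)).trace
        = ∑ i, ∑ j, ∑ k, ∑ l, (R (x * t)) i j * (R (x * t)⁻¹) k l * (B' j l * B k i) := by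
      intro x
      have h1 : R (x * t) = B' * (R (x * t)⁻¹).transpose * B := by
        have h2 := hout _ (hxt x)
        have h3 := congrArg Matrix.transpose (hRcancel (x * t))
        rw [Matrix.transpose_mul, Matrix.transpose_one] at h3
        rw [one_smul] at h2
        calc R (x * t) = B' * (((R (x * t)⁻¹).transpose * (R (x * t)).transpose) * B * R (x * t)) := by
              rw [h3, one_mul, ← mul_assoc, hB'B, one_mul]
          _ = B' * ((R (x * t)⁻¹).transpose * ((R (x * t)).transpose * B * R (x * t))) := by
              simp only [mul_assoc]
          _ = _ := by rw [h2, mul_assoc]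
      rw [pow_two, map_mul]
      conv_lhs => rw [Matrix.trace]
      refine Finset.sum_congr rfl fun i _ => ?_
      rw [Matrix.diag_apply, Matrix.mul_apply]
      refine Finset.sum_congr rfl fun j _ => ?_
      have h4 : (R (x * t)) j i = ∑ k, ∑ l, B' j l * (R (x * t)⁻¹) k l * B k i := by
        rw [h1, Matrix.mul_apply]
        refine Finset.sum_congr rfl fun k _ => ?_
        rw [Matrix.mul_apply, Finset.sum_mul]
        refine Finset.sum_congr rfl fun l _ => ?_
        rfl
      rw [h4, Finset.mul_sum]
      refine Finset.sum_congr rfl fun k _ => ?_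
      rw [Finset.mul_sum]
      refine Finset.sum_congr rfl fun l _ => ?_
      ring
    simp only [hterm]
    have hswap : ∑ x : N, ∑ i, ∑ j, ∑ k, ∑ l,
          (R (x * t)) i j * (R (x * t)⁻¹) k l * (B' j l * B k i)
        = ∑ i, ∑ j, ∑ k, ∑ l,
          (∑ x : N, (R (x * t)) i j * (R (x * t)⁻¹) k l) * (B' j l * B k i) := by
      rw [Finset.sum_comm]
      refine Finset.sum_congr rfl fun i _ => ?_
      rw [Finset.sum_comm]
      refine Finset.sum_congr rfl fun j _ => ?_
      rw [Finset.sum_comm]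
      refine Finset.sum_congr rfl fun k _ => ?_
      rw [Finset.sum_comm]
      refine Finset.sum_congr rfl fun l _ => ?_
      rw [Finset.sum_mul]
    rw [hswap]
    simp only [hent]
    have hij : ∀ i j : Fin n, ∑ k, ∑ l,
        (if i = l ∧ j = k then (Nat.card N : ℂ) / n else 0) * (B' j l * B k i)
        = (Nat.card N : ℂ) / n * (B' i j * B j i) := by
      intro i j
      rw [Finset.sum_eq_single j, Finset.sum_eq_single i]
      · have : B' j i = B' i j := by
          conv_lhs => rw [← hsym']
          rfl
        simp [this]
      · intro l _ hl
        simp [hl.symm]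
      · simp
      · intro k _ hk
        simp [hk.symm]
      · simp
    simp only [hij]
    simp only [← Finset.mul_sum, ← Matrix.mul_apply, hB'B]
    simp
    field_simp

lemma mem_sup_cases {G : Type*} [Group G] (N : Subgroup G) [N.Normal] (t : G) (ht2 : t ^ 2 ∈ N)
    (m : G) (hm : m ∈ N ⊔ Subgroup.zpowers t) : m ∈ N ∨ m * t⁻¹ ∈ N := by
  obtain ⟨y, hy, z, hz, rfl⟩ := Subgroup.mem_sup_of_normal_left.mp hm
  obtain ⟨k, rfl⟩ := Subgroup.mem_zpowers_iff.mp hz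
  have h2 : ∀ j : ℤ, t ^ (2 * j) ∈ N := by
    intro j
    rw [zpow_mul]
    exact N.zpow_mem (by exact_mod_cast ht2) j
  rcases Int.even_or_odd' k with ⟨j, rfl | rfl⟩
  · left
    exact N.mul_mem hy (h2 j)
  · right
    rw [zpow_add_one, mul_assoc, mul_assoc, mul_inv_cancel, mul_one]
    exact N.mul_mem hy (h2 j)

lemma exists_extension {G : Type*} [Group G] [Fintype G] (N : Subgroup G) [N.Normal] {n : ℕ}
    (ρ : N →* Mt n) (hn : (n : ℂ) ≠ 0) (hs : ScalComm ρ)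
    (hχ : ∑ h : N, (ρ h).trace * (ρ h⁻¹).trace = (Nat.card N : ℂ))
    (t : G) (htn : t ∉ N) (ht2 : t ^ 2 ∈ N)
    (hinv : ∀ x : N, (ρ (MulAut.conjNormal t x)).trace = (ρ x).trace) :
    ∃ R : ↥(N ⊔ Subgroup.zpowers t) →* Mt n,
      ∀ x : N, R ⟨x, (le_sup_left : N ≤ N ⊔ Subgroup.zpowers t) x.2⟩ = ρ x := by
  have hcN : (Nat.card N : ℂ) ≠ 0 := by exact_mod_cast Nat.card_pos.ne'
  let φ : N →* N := (MulAut.conjNormal t : MulAut N).toMonoidHom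
  have hφ : ∀ x : N, ((φ x : N) : G) = t * x * t⁻¹ := fun x => MulAut.conjNormal_apply t x
  obtain ⟨T, T', hTT', hT'T, hT⟩ := exists_intertwiner ρ (ρ.comp φ) hn hs (by
    have : ∑ h : N, ((ρ.comp φ) h).trace * (ρ h⁻¹).trace = Nat.card N := by
      rw [← hχ]
      refine Finset.sum_congr rfl fun x _ => ?_
      congr 1
      exact hinv x
    rw [this]
    exact hcN)
  replace hT : ∀ x, T * ρ x = ρ (φ x) * T := hT
  let s : N := ⟨t ^ 2, ht2⟩
  have hφφ : ∀ x : N, φ (φ x) = s * x * s⁻¹ := by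
    intro x
    apply Subtype.ext
    rw [hφ, hφ]
    simp only [s, Subgroup.coe_mul, Subgroup.coe_inv]
    rw [pow_two]
    group
  obtain ⟨c, hc⟩ := hs (ρ s⁻¹ * (T * T)) (by
    intro x
    calc ρ s⁻¹ * (T * T) * ρ x = ρ s⁻¹ * (T * (T * ρ x)) := by simp only [mul_assoc]
      _ = ρ s⁻¹ * (ρ (φ (φ x)) * T * T) := by
          rw [hT, ← mul_assoc T, hT]
      _ = ρ (s⁻¹ * φ (φ x)) * (T * T) := by rw [map_mul]; simp only [mul_assoc]
      _ = ρ (x * s⁻¹) * (T * T) := by rw [hφφ]; congr 2; group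
      _ = ρ x * (ρ s⁻¹ * (T * T)) := by rw [map_mul, mul_assoc])
  have hTTc : T * T = c • ρ s := by
    calc T * T = ρ s * (ρ s⁻¹ * (T * T)) := by rw [← mul_assoc, ← map_mul]; simp
      _ = c • ρ s := by rw [hc, mul_smul_comm, mul_one]
  have hc0 : c ≠ 0 := by
    rintro rfl
    rw [zero_smul] at hTTc
    have h1 : (1 : Mt n) = T' * (T' * (T * T)) := by
      rw [← mul_assoc T' T T, hT'T, one_mul, hT'T]
    rw [hTTc, mul_zero, mul_zero] at h1
    have := congrArg Matrix.trace h1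
    rw [Matrix.trace_zero, Matrix.trace_one, Fintype.card_fin] at this
    exact hn this
  obtain ⟨z, hz⟩ := IsAlgClosed.exists_pow_nat_eq c (n := 2) two_pos
  have hz0 : z ≠ 0 := by
    rintro rfl
    apply hc0
    rw [← hz]; simp
  set U : Mt n := z⁻¹ • T with hU
  have hUU : U * U = ρ s := by
    rw [hU, smul_mul_smul_comm, hTTc, smul_smul, ← hz]
    have : z⁻¹ * z⁻¹ * z ^ 2 = 1 := by field_simp
    rw [this, one_smul]
  have hUρ : ∀ x, U * ρ x = ρ (φ x) * U := by
    intro x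
    rw [hU, smul_mul_assoc, hT, mul_smul_comm]
  let R0 : G → Mt n := fun m =>
    if h : m ∈ N then ρ ⟨m, h⟩ else if h' : m * t⁻¹ ∈ N then ρ ⟨m * t⁻¹, h'⟩ * U else 0
  have hR1 : ∀ x : N, R0 x = ρ x := by
    intro x
    simp only [R0]
    rw [dif_pos x.2]
  have hR2 : ∀ x : N, R0 (x * t) = ρ x * U := by
    intro x
    have h1 : (x : G) * t ∉ N := fun hx => htn ((Subgroup.mul_mem_cancel_left N x.2).mp hx)
    have h2 : (x : G) * t * t⁻¹ = x := by group
    have h3 : (x : G) * t * t⁻¹ ∈ N := by rw [h2]; exact x.2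
    simp only [R0]
    rw [dif_neg h1, dif_pos h3]
    congr 2
    exact Subtype.ext h2
  have hform : ∀ m : ↥(N ⊔ Subgroup.zpowers t), (∃ x : N, (m : G) = x) ∨ ∃ x : N, (m : G) = x * t := by
    intro m
    rcases mem_sup_cases N t ht2 m m.2 with h | h
    · exact Or.inl ⟨⟨m, h⟩, rfl⟩
    · exact Or.inr ⟨⟨_, h⟩, by simp⟩
  refine ⟨⟨⟨fun m => R0 m, ?_⟩, ?_⟩, fun x => hR1 x⟩
  · have := hR1 1
    simpa using this
  · intro a b
    change R0 ((a : G) * b) = R0 a * R0 b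
    rcases hform a with ⟨x, hx⟩ | ⟨x, hx⟩ <;> rcases hform b with ⟨y, hy⟩ | ⟨y, hy⟩ <;> rw [hx, hy]
    · rw [← Subgroup.coe_mul, hR1, hR1, hR1, map_mul]
    · rw [← mul_assoc, ← Subgroup.coe_mul, hR2, hR1, hR2, map_mul, mul_assoc]
    · have : (x : G) * t * y = ((x * φ y : N) : G) * t := by
        rw [Subgroup.coe_mul, hφ]; group
      rw [this, hR2, hR2, hR1, map_mul, mul_assoc, mul_assoc, hUρ]
    · have : (x : G) * t * (y * t) = ((x * φ y * s : N) : G) := by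
        rw [Subgroup.coe_mul, Subgroup.coe_mul, hφ]
        simp only [s]
        rw [pow_two]
        group
      rw [this, hR1, hR2, hR2, map_mul, map_mul, ← hUU]
      calc ρ x * ρ (φ y) * (U * U) = ρ x * (ρ (φ y) * U) * U := by simp only [mul_assoc]
        _ = _ := by rw [← hUρ]; simp only [mul_assoc]

/-- pass from a character to a matrix representation -/
lemma IsChar.exists_matrix {H : Type*} [Group H] [Fintype H] {χ : H → ℂ} (h : IsChar H χ) :
    ∃ (n : ℕ) (ρ : H →* Mt n), ∀ g, χ g = (ρ g).trace := by
  obtain ⟨n, r, hr⟩ := h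
  refine ⟨n, ((LinearMap.toMatrixAlgEquiv' : _ ≃ₐ[ℂ] Mt n) : _ →* Mt n).comp r, fun g => ?_⟩
  rw [hr]
  exact LinearMap.trace_eq_matrix_trace ℂ (Pi.basisFun ℂ (Fin n)) (r g)

lemma apply_main {G : Type*} [Group G] [Fintype G] (N : Subgroup G) [N.Normal]
    (θ : ↥N → ℂ) (hθ : IsIrrChar ↥N θ) (hreal : IsRealChar ↥N θ)
    (hdef : ∃ d : ℕ, Odd d ∧ θ 1 * (d : ℂ) = (Nat.card N : ℂ))
    (t : G) (htn : t ∉ N) (ht2 : t ^ 2 ∈ N) {n : ℕ}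
    (R : ↥(N ⊔ Subgroup.zpowers t) →* Mt n)
    (hR : ∀ x : N, (R ⟨x, (le_sup_left : N ≤ N ⊔ Subgroup.zpowers t) x.2⟩).trace = θ x) :
    (∀ m, (R m⁻¹).trace = (R m).trace) ∧ Gow N θ t = 1 := by
  obtain ⟨d, hd, hdn⟩ := hdef
  have hle : N ≤ N ⊔ Subgroup.zpowers t := le_sup_left
  have htm : t ∈ N ⊔ Subgroup.zpowers t :=
    (le_sup_right : Subgroup.zpowers t ≤ _) (Subgroup.mem_zpowers t)
  let e := Subgroup.subgroupOfEquivOfLe hle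
  have hcard : Nat.card (N.subgroupOf (N ⊔ Subgroup.zpowers t)) = Nat.card N :=
    Nat.card_congr e.toEquiv
  have hcN : (Nat.card N : ℂ) ≠ 0 := by exact_mod_cast Nat.card_pos.ne'
  have hθ1 : θ 1 = n := by
    rw [← hR]
    have : (⟨((1 : N) : G), hle (1 : N).2⟩ : ↥(N ⊔ Subgroup.zpowers t)) = 1 := rfl
    rw [this, map_one, Matrix.trace_one, Fintype.card_fin]
  have hRe : ∀ x : N.subgroupOf (N ⊔ Subgroup.zpowers t), (R x).trace = θ (e x) := fun x => hR (e x)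
  have hRr : ∀ x ∈ N.subgroupOf (N ⊔ Subgroup.zpowers t), (R x⁻¹).trace = (R x).trace := by
    intro x hx
    rw [← conj_trace, hRe ⟨x, hx⟩]
    exact hreal _
  obtain ⟨h1, h2⟩ := inner_main R (N.subgroupOf (N ⊔ Subgroup.zpowers t)) ⟨t, htm⟩ htn ht2
    (fun m => mem_sup_cases N t ht2 m m.2) (by
      rw [hcard, Nat.card_eq_fintype_card, ← hθ.2]
      refine Fintype.sum_equiv e.toEquiv _ _ fun x => ?_
      rw [hRr x x.2, hRe x]
      exact congrArg (fun y => θ (e x) * y) (hreal (e x)).symm) hRr d hd (by rw [hcard, ← hθ1, hdn])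
  refine ⟨h1, ?_⟩
  rw [hcard] at h2
  rw [Gow, div_eq_one_iff_eq hcN, ← h2]
  symm
  refine Fintype.sum_equiv e.toEquiv _ _ fun x => ?_
  have hmem : (((e x : N) : G) * t) ^ 2 ∈ N := by
    have : (((e x : N) : G) * t) ^ 2
        = (e x : N) * (t * (e x : N) * t⁻¹) * t ^ 2 := by
      rw [pow_two, pow_two]; group
    rw [this]
    exact N.mul_mem (N.mul_mem (e x).2
      (Subgroup.Normal.conj_mem inferInstance _ (e x).2 t)) ht2
  change _ = ext0 N θ ((((e x : N) : G) * t) ^ 2)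
  rw [ext0, dif_pos hmem, ← hR]
  rfl


/-- for `θ` real of 2-defect zero and `t ∉ N` with `t² ∈ N`, `θ^t = θ`,
every character of `N⟨t⟩` extending `θ` is real-valued; equivalently `ε_t(θ) = +1`. -/
theorem stmt15 {G : Type*} [Group G] [Fintype G] (N : Subgroup G) [N.Normal]
    (θ : ↥N → ℂ) (hθ : IsIrrChar ↥N θ) (hreal : IsRealChar ↥N θ)
    (hdef : ∃ d : ℕ, Odd d ∧ θ 1 * (d : ℂ) = (Nat.card N : ℂ))
    (t : G) (htn : t ∉ N) (ht2 : t ^ 2 ∈ N) (hinv : conjChar N θ t = θ) :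
    (∀ ψ : ↥(N ⊔ Subgroup.zpowers t) → ℂ, IsChar ↥(N ⊔ Subgroup.zpowers t) ψ →
        (∀ n : ↥N, ψ ⟨↑n, (le_sup_left : N ≤ N ⊔ Subgroup.zpowers t) n.2⟩ = θ n) →
        IsRealChar ↥(N ⊔ Subgroup.zpowers t) ψ) ∧
      Gow N θ t = 1 := by
  refine ⟨?_, ?_⟩
  · intro ψ hψ hext
    obtain ⟨n, R, hR⟩ := hψ.exists_matrix
    obtain ⟨h1, -⟩ := apply_main N θ hθ hreal hdef t htn ht2 R
      (fun x => by rw [← hR, hext])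
    intro g
    rw [hR, conj_trace, h1]
  · obtain ⟨n, ρ, hρ⟩ := hθ.1.exists_matrix
    have hcN : (Nat.card N : ℂ) ≠ 0 := by exact_mod_cast Nat.card_pos.ne'
    have hn : (n : ℂ) ≠ 0 := by
      obtain ⟨d, -, hd⟩ := hdef
      rw [hρ, map_one, Matrix.trace_one, Fintype.card_fin] at hd
      intro h0
      rw [h0, zero_mul] at hd
      exact hcN hd.symm
    have hχ : ∑ h : N, (ρ h).trace * (ρ h⁻¹).trace = (Nat.card N : ℂ) := by
      rw [Nat.card_eq_fintype_card, ← hθ.2]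
      refine Finset.sum_congr rfl fun x _ => ?_
      rw [← conj_trace, ← hρ]
    obtain ⟨R, hR⟩ := exists_extension N ρ hn (scalComm_of_norm ρ hχ) hχ t htn ht2 (by
      intro x
      rw [← hρ, ← hρ]
      have h1 := congrFun hinv x
      have hmem : t * (x : G) * t⁻¹ ∈ N := Subgroup.Normal.conj_mem inferInstance _ x.2 t
      rw [conjChar, ext0, dif_pos hmem] at h1
      exact h1)
    exact (apply_main N θ hθ hreal hdef t htn ht2 R (fun x => by rw [hR, hρ])).2
end
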